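/- arXiv:1705.05790 — 9 statements merged into one kernel-verified Lean document; each statement's English description precedes it below -/
import Mathlib

section
/- A finite simple graph G is odd chordal if and only if, for every even cycle C in G, the transition graph 𝒢(G[C]) of the subgraph of G induced by the vertices of C is connected and has diameter exactly |C|/2 − 1, where |C| is the number of vertices of C. -/
/-- A perfect matching of `G`, viewed as a set of edges: a set of pairwise
disjoint edges of `G` covering every vertex. -/
def IsPM {V : Type*} (G : SimpleGraph V) (M : Set (Sym2 V)) : Prop :=
  M ⊆ G.edgeSet ∧
    (∀ e ∈ M, ∀ f ∈ M, e ≠ f → ∀ v : V, ¬(v ∈ e ∧ v ∈ f)) ∧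
    (∀ v : V, ∃ e ∈ M, v ∈ e)

/-- Two perfect matchings differ by a switch. -/
def IsSwitch {V : Type*} (G : SimpleGraph V) (M M' : Set (Sym2 V)) : Prop :=
  ∃ u v u' v' : V, u ≠ v ∧ u ≠ u' ∧ u ≠ v' ∧ v ≠ u' ∧ v ≠ v' ∧ u' ≠ v' ∧
    s(u, v) ∈ M ∧ s(u', v') ∈ M ∧ G.Adj u' v ∧ G.Adj u v' ∧
    M' = (M \ {s(u, v), s(u', v')}) ∪ {s(u', v), s(u, v')}

/-- The transition graph of the switch chain on `G`: vertices are the perfect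
matchings of `G`, two of them adjacent iff they differ by a switch. -/
def TransGraph {V : Type*} (G : SimpleGraph V) :
    SimpleGraph {M : Set (Sym2 V) // IsPM G M} :=
  SimpleGraph.fromRel fun M N => IsSwitch G M.1 N.1

/-- `c` is (a parametrization of) a cycle of length `m` in `G`. -/
def IsCycleEmb {V : Type*} (G : SimpleGraph V) {m : ℕ} (c : ZMod m → V) : Prop :=
  Function.Injective c ∧ ∀ i : ZMod m, G.Adj (c i) (c (i + 1))

/-- The cycle `c` has a chord (an edge of `G` joining two non-consecutive
vertices of the cycle). -/
def HasChord {V : Type*} (G : SimpleGraph V) {m : ℕ} (c : ZMod m → V) : Prop :=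
  ∃ i j : ZMod m, G.Adj (c i) (c j) ∧ j ≠ i + 1 ∧ i ≠ j + 1

/-- The even cycle `c` (of length `2 * r`) has an odd chord. -/
def HasOddChord {V : Type*} (G : SimpleGraph V) {r : ℕ} (c : ZMod (2 * r) → V) : Prop :=
  ∃ i j : ZMod (2 * r), G.Adj (c i) (c j) ∧ j ≠ i + 1 ∧ i ≠ j + 1 ∧ Odd (j - i).val

/-- Every even cycle of length at least 6 in `G` has an odd chord. -/
def OddChordal {V : Type*} (G : SimpleGraph V) : Prop :=
  ∀ r : ℕ, 3 ≤ r → ∀ c : ZMod (2 * r) → V, IsCycleEmb G c → HasOddChord G c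

/-- The even cycle `c` (of length `2 * r`) has an even switch (a pair of even
chords of the form `(c a, c (a + d))`, `(c (a + 1), c (a + d + 1))` with `d`
even) together with a crossing chord: a chord of the cycle with one endpoint
on the path `c (a + 1), …, c (a + d)` and the other on the path
`c (a + d + 1), …, c a`. -/
def HasEvenSwitchWithCrossingChord {V : Type*} (G : SimpleGraph V) {r : ℕ}
    (c : ZMod (2 * r) → V) : Prop :=
  ∃ a : ZMod (2 * r), ∃ d : ℕ, 2 ≤ d ∧ d ≤ 2 * r - 2 ∧ Even d ∧
    G.Adj (c a) (c (a + (d : ZMod (2 * r)))) ∧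
    G.Adj (c (a + 1)) (c (a + (d : ZMod (2 * r)) + 1)) ∧
    ∃ s t : ℕ, 1 ≤ s ∧ s ≤ d ∧ d + 1 ≤ t ∧ t ≤ 2 * r ∧
      G.Adj (c (a + (s : ZMod (2 * r)))) (c (a + (t : ZMod (2 * r)))) ∧
      a + (t : ZMod (2 * r)) ≠ a + (s : ZMod (2 * r)) + 1 ∧
      a + (s : ZMod (2 * r)) ≠ a + (t : ZMod (2 * r)) + 1

/-- Every even cycle of length at least 6 in `G` has an odd chord or has an
even switch with a crossing chord. -/
def Switchable {V : Type*} (G : SimpleGraph V) : Prop :=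
  ∀ r : ℕ, 3 ≤ r → ∀ c : ZMod (2 * r) → V, IsCycleEmb G c →
    HasOddChord G c ∨ HasEvenSwitchWithCrossingChord G c


/-- `f` is the partner function of a perfect matching of `H`. -/
def Mat {W : Type*} (H : SimpleGraph W) (f : W → W) : Prop :=
  (∀ x, f (f x) = x) ∧ ∀ x, H.Adj x (f x)

/-- The edge set of a partner function. -/
def edgesOf {W : Type*} (f : W → W) : Set (Sym2 W) := {e | ∃ x, e = s(x, f x)}

lemma mem_edgesOf {W : Type*} {H : SimpleGraph W} {f : W → W} (hf : Mat H f) (x y : W) :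
    s(x, y) ∈ edgesOf f ↔ f x = y := by
  constructor
  · rintro ⟨z, hz⟩
    rcases Sym2.eq_iff.1 hz with ⟨rfl, rfl⟩ | ⟨rfl, rfl⟩
    · rfl
    · exact hf.1 _
  · rintro rfl
    exact ⟨x, rfl⟩

lemma isPM_edgesOf {W : Type*} {H : SimpleGraph W} {f : W → W} (hf : Mat H f) :
    IsPM H (edgesOf f) := by
  refine ⟨?_, ?_, fun v => ⟨s(v, f v), ⟨v, rfl⟩, by simp⟩⟩
  · rintro e ⟨x, rfl⟩
    exact hf.2 x
  · rintro e ⟨x, rfl⟩ e' ⟨y, rfl⟩ hne v ⟨h1, h2⟩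
    apply hne
    have key : ∀ x v : W, v ∈ s(x, f x) → s(x, f x) = s(v, f v) := by
      intro x v h
      rcases Sym2.mem_iff.1 h with rfl | rfl
      · rfl
      · rw [hf.1, Sym2.eq_swap]
    rw [key x v h1, key y v h2]

/-- The perfect matching of a partner function. -/
def toPM {W : Type*} {H : SimpleGraph W} {f : W → W} (hf : Mat H f) :
    {M : Set (Sym2 W) // IsPM H M} := ⟨edgesOf f, isPM_edgesOf hf⟩

lemma exists_mat {W : Type*} {H : SimpleGraph W} (M : {M : Set (Sym2 W) // IsPM H M}) :
    ∃ (f : W → W) (hf : Mat H f), M = toPM hf := by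
  obtain ⟨M, h1, h2, h3⟩ := M
  have h4 : ∀ v, ∃ w, s(v, w) ∈ M := by
    intro v
    obtain ⟨e, he, hv⟩ := h3 v
    obtain ⟨w, rfl⟩ := Sym2.mem_iff_exists.1 hv
    exact ⟨w, he⟩
  choose f hf using h4
  have huniq : ∀ v w, s(v, w) ∈ M → f v = w := by
    intro v w hw
    by_contra hne
    refine h2 _ (hf v) _ hw ?_ v ⟨by simp, by simp⟩
    intro h
    exact hne (Sym2.congr_right.1 h)
  have hm : Mat H f := by
    refine ⟨fun x => huniq _ _ ?_, fun x => h1 (hf x)⟩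
    rw [Sym2.eq_swap]; exact hf x
  refine ⟨f, hm, Subtype.ext ?_⟩
  ext e
  induction e using Sym2.ind with
  | _ x y =>
    change _ ↔ s(x, y) ∈ edgesOf f
    rw [mem_edgesOf hm]
    exact ⟨huniq x y, fun h => h ▸ hf x⟩

lemma isSwitch_symm {W : Type*} {H : SimpleGraph W} {M N : {M : Set (Sym2 W) // IsPM H M}}
    (h : IsSwitch H M.1 N.1) : IsSwitch H N.1 M.1 := by
  obtain ⟨f, hf, rfl⟩ := exists_mat M
  obtain ⟨u, v, u', v', h1, h2, h3, h4, h5, h6, m1, m2, a1, a2, e⟩ := h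
  change s(u, v) ∈ edgesOf f at m1
  change s(u', v') ∈ edgesOf f at m2
  have e1 := (mem_edgesOf hf _ _).1 m1
  have e2 := (mem_edgesOf hf _ _).1 m2
  refine ⟨u', v, u, v', h4.symm, h2.symm, h6, h1.symm, h5, h3, ?_, ?_, (isPM_edgesOf hf).1 m1,
    (isPM_edgesOf hf).1 m2, ?_⟩
  · rw [e]; right; simp
  · rw [e]; right; simp
  · have n1 : s(u', v) ∉ edgesOf f := by
      rw [mem_edgesOf hf, e2]; exact h5.symm
    have n2 : s(u, v') ∉ edgesOf f := by
      rw [mem_edgesOf hf, e1]; exact h5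
    rw [e]
    change edgesOf f = ((edgesOf f \ _) ∪ _) \ _ ∪ _
    ext x
    simp only [Set.mem_union, Set.mem_sdiff, Set.mem_insert_iff, Set.mem_singleton_iff]
    constructor
    · intro hx
      by_cases hx1 : x = s(u, v) ∨ x = s(u', v')
      · right; exact hx1
      · left
        refine ⟨Or.inl ⟨hx, hx1⟩, ?_⟩
        rintro (rfl | rfl)
        · exact n1 hx
        · exact n2 hx
    · rintro (⟨⟨hx, _⟩ | hx, hx2⟩ | rfl | rfl)
      · exact hx
      · exact absurd hx hx2
      · exact m1
      · exact m2

lemma isSwitch_of_adj {W : Type*} {H : SimpleGraph W} {M N : {M : Set (Sym2 W) // IsPM H M}}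
    (h : (TransGraph H).Adj M N) : IsSwitch H M.1 N.1 := by
  rcases h with ⟨_, h | h⟩
  · exact h
  · exact isSwitch_symm h

/-- Labelling lemma: along a walk of length `l`, a labelling loses at most `l` labels. -/
lemma label_walk {W : Type*} [Finite W] {H : SimpleGraph W}
    {M N : {M : Set (Sym2 W) // IsPM H M}} (p : (TransGraph H).Walk M N) :
    ∀ g : W → ℕ, (∀ u v, s(u, v) ∈ M.1 → g u = g v) →
      ∃ g' : W → ℕ, (∀ u v, s(u, v) ∈ N.1 → g' u = g' v) ∧ (∀ u v, g u = g v → g' u = g' v) ∧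
        (Set.range g).ncard ≤ (Set.range g').ncard + p.length := by
  induction p with
  | nil => intro g hg; exact ⟨g, hg, fun _ _ h => h, by simp⟩
  | @cons M N' N h p ih =>
    intro g hg
    obtain ⟨u, v, u', v', h1, h2, h3, h4, h5, h6, m1, m2, a1, a2, e⟩ := isSwitch_of_adj h
    have e1 := hg _ _ m1
    have e2 := hg _ _ m2
    obtain ⟨g', hg', hco, hc⟩ := ih (fun x => if g x = g u' then g u else g x) (by
      intro x y hxy
      rw [e] at hxy
      rcases hxy with ⟨hxy, _⟩ | hxy
      · simp only [hg _ _ hxy]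
      · rcases hxy with hxy | hxy <;> rcases Sym2.eq_iff.1 hxy with ⟨rfl, rfl⟩ | ⟨rfl, rfl⟩ <;>
          simp [e1, e2])
    refine ⟨g', hg', fun x y hxy => hco x y (by simp only [hxy]), ?_⟩
    have hsub : Set.range g ⊆
        insert (g u') (Set.range (fun x => if g x = g u' then g u else g x)) := by
      rintro _ ⟨x, rfl⟩
      by_cases hx : g x = g u'
      · left; exact hx
      · right; exact ⟨x, by simp [hx]⟩
    have := Set.ncard_le_ncard hsub (Set.toFinite _)
    have := Set.ncard_insert_le (g u') (Set.range (fun x => if g x = g u' then g u else g x))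
    simp only [SimpleGraph.Walk.length_cons]
    omega

/-- alternation -/
def alt {W : Type*} (f f' : W → W) (n : ℕ) : W → W := if Even n then f else f'

lemma alt_succ {W : Type*} (f f' : W → W) (n : ℕ) : alt f f' (n + 1) = alt f' f n := by
  unfold alt; by_cases h : Even n <;> simp [h, Nat.even_add_one]

/-- An alternating path with `2 * k` vertices whose ends are adjacent. -/
def Good {W : Type*} (H : SimpleGraph W) (f f' : W → W) (k : ℕ) : Prop :=
  2 ≤ k ∧ ∃ p : ℕ → W, (∀ i j, i < 2 * k → j < 2 * k → p i = p j → i = j) ∧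
    (∀ i, i + 1 < 2 * k → p (i + 1) = alt f f' i (p i)) ∧ H.Adj (p (2 * k - 1)) (p 0)

lemma alt_add {W : Type*} (f f' : W → W) (a n : ℕ) :
    alt f f' (a + n) = if Even a then alt f f' n else alt f' f n := by
  induction a generalizing f f' with
  | zero => simp
  | succ a ih =>
    rw [show a + 1 + n = (a + n) + 1 by ring, alt_succ, ih]
    by_cases h : Even a <;> simp [h, Nat.even_add_one]

/-- the alternating sequence -/
def altSeq {W : Type*} (f f' : W → W) (x : W) : ℕ → W
  | 0 => x
  | n + 1 => alt f f' n (altSeq f f' x n)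

lemma exists_good {W : Type*} [Finite W] {H : SimpleGraph W} {f f' : W → W} (hf : Mat H f)
    (hf' : Mat H f') (hne : f ≠ f') : ∃ k, Good H f f' k := by
  obtain ⟨x, hx⟩ := Function.ne_iff.1 hne
  set p := altSeq f f' x with hp
  have hps : ∀ n, p (n + 1) = alt f f' n (p n) := fun n => rfl
  have inv : ∀ n y, alt f f' n (alt f f' n y) = y := by
    intro n y; unfold alt; split_ifs
    · exact hf.1 y
    · exact hf'.1 y
  have nofix : ∀ n y, alt f f' n y ≠ y := by
    intro n y; unfold alt; split_ifs
    · exact (hf.2 y).ne'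
    · exact (hf'.2 y).ne'
  have hdis : ∀ n, f (p n) ≠ f' (p n) := by
    intro n
    induction n with
    | zero => exact hx
    | succ n ih =>
      intro h
      have h2 := hps n
      unfold alt at h2
      split_ifs at h2
      · apply ih
        rw [h2, hf.1] at h
        have := congrArg f' h
        rw [hf'.1] at this
        exact this.symm
      · apply ih
        rw [h2, hf'.1] at h
        have := congrArg f h
        rw [hf.1] at this
        exact this.symm
  have hex : ∃ j, ∃ i, i < j ∧ p i = p j := by
    obtain ⟨i, j, hij, he⟩ := Finite.exists_ne_map_eq_of_infinite p
    rcases lt_or_gt_of_ne hij with h | h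
    · exact ⟨j, i, h, he⟩
    · exact ⟨i, j, h, he.symm⟩
  classical
  obtain ⟨i, hij, he⟩ := Nat.find_spec hex
  have hmin : ∀ a b, a < Nat.find hex → b < Nat.find hex → p a = p b → a = b := by
    intro a b ha hb hab
    by_contra hne
    rcases lt_or_gt_of_ne hne with h | h
    · exact Nat.find_min hex hb ⟨a, h, hab⟩
    · exact Nat.find_min hex ha ⟨b, h, hab.symm⟩
  set j := Nat.find hex with hj
  clear_value j
  obtain ⟨j, rfl⟩ : ∃ j', j = j' + 1 := ⟨j - 1, by omega⟩
  have hb : p j = alt f f' j (p i) := by rw [he, hps, inv]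
  have hij' : i ≠ j := by
    rintro rfl
    exact nofix _ _ hb.symm
  have halt : ∀ a b, (Even a ↔ Even b) → alt f f' a = alt f f' b := by
    intro a b h; unfold alt; simp [h]
  have hj1 : j ≠ i + 1 := by
    rintro rfl
    rw [hps] at hb
    have h1 := hdis i
    unfold alt at hb
    by_cases hi : Even i <;> simp [hi, Nat.even_add_one] at hb
    · exact h1 hb
    · exact h1 hb.symm
  have hpar : ¬ (Even j ↔ Even i) := by
    intro h
    rw [halt j i h, ← hps] at hb
    exact hj1 (hmin _ _ (by omega) (by omega) hb)
  have hi0 : i = 0 := by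
    by_contra h0
    obtain ⟨i, rfl⟩ := Nat.exists_eq_succ_of_ne_zero h0
    simp only [Nat.succ_eq_add_one] at *
    rw [halt j i (by rw [Nat.even_add_one] at hpar; tauto), hps, inv] at hb
    have := hmin _ _ (by omega) (by omega) hb
    omega
  subst hi0
  have hodd : Odd j := by simpa using hpar
  obtain ⟨k, rfl⟩ := hodd
  refine ⟨k + 1, by omega, p, fun a b ha hb h => hmin a b (by omega) (by omega) h,
    fun i _ => hps i, ?_⟩
  have : p 0 = f' (p (2 * k + 1)) := by rw [he, hps]; simp [alt]
  rw [this]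
  exact hf'.2 _

lemma odd_val_sub {m : ℕ} (hm : 0 < m) (i j : ZMod (2 * m)) :
    Odd (j - i).val ↔ (Odd j.val ↔ Even i.val) := by
  have : NeZero (2 * m) := ⟨by omega⟩
  have h : j.val = ((j - i).val + i.val) % (2 * m) := by
    rw [← ZMod.val_add]; simp
  have h2 : j.val % 2 = ((j - i).val + i.val) % 2 := by
    rw [h, Nat.mod_mul_right_mod]
  rw [Nat.odd_iff, Nat.odd_iff, Nat.even_iff]
  omega

lemma val_succ {m : ℕ} (hm : 0 < m) (i : ZMod (2 * m)) :
    (i + 1).val = if i.val + 1 = 2 * m then 0 else i.val + 1 := by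
  have : NeZero (2 * m) := ⟨by omega⟩
  have h1 : (1 : ZMod (2 * m)).val = 1 := ZMod.val_one'' (by omega)
  have := ZMod.val_lt i
  rw [ZMod.val_add, h1]
  split_ifs with h
  · rw [h, Nat.mod_self]
  · exact Nat.mod_eq_of_lt (by omega)

lemma good_reduce {W : Type*} {H : SimpleGraph W} (hH : OddChordal H) {f f' : W → W} {k : ℕ}
    (hk : 3 ≤ k) (hg : Good H f f' k) (hf : Mat H f) (hf' : Mat H f') :
    ∃ k' < k, Good H f f' k' ∨ Good H f' f k' := by
  obtain ⟨_, p, hinj, hstep, hadj⟩ := hg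
  have : NeZero (2 * k) := ⟨by omega⟩
  have hcyc : IsCycleEmb H (fun i : ZMod (2 * k) => p i.val) := by
    constructor
    · intro i j hij
      exact ZMod.val_injective _ (hinj _ _ (ZMod.val_lt i) (ZMod.val_lt j) hij)
    · intro i
      change H.Adj (p i.val) (p (i + 1).val)
      rw [val_succ (by omega)]
      have := ZMod.val_lt i
      split_ifs with h
      · rw [show i.val = 2 * k - 1 by omega]; exact hadj
      · rw [hstep _ (by omega)]
        unfold alt; split_ifs
        · exact hf.2 _
        · exact hf'.2 _
  obtain ⟨i, j, ha, h1, h2, hodd⟩ := hH k hk _ hcyc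
  rw [odd_val_sub (by omega)] at hodd
  have hc : ∃ a b, a + 1 < b ∧ b < 2 * k ∧ ¬ (a = 0 ∧ b = 2 * k - 1) ∧ (Odd b ↔ Even a) ∧
      H.Adj (p a) (p b) := by
    have hi := ZMod.val_lt i
    have hj := ZMod.val_lt j
    have h1' : j.val ≠ (i + 1).val := fun h => h1 (ZMod.val_injective _ h)
    have h2' : i.val ≠ (j + 1).val := fun h => h2 (ZMod.val_injective _ h)
    rw [val_succ (by omega)] at h1' h2'
    have hne : i.val ≠ j.val := by
      intro h; rw [h, ← Nat.not_even_iff_odd] at hodd; tauto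
    rcases lt_or_gt_of_ne hne with h | h
    · refine ⟨i.val, j.val, ?_, hj, ?_, hodd, ha⟩
      · split_ifs at h1' <;> omega
      · rintro ⟨h3, h4⟩; apply h2'; rw [if_pos (by omega)]; exact h3
    · refine ⟨j.val, i.val, ?_, hi, ?_, ?_, ha.symm⟩
      · split_ifs at h2' <;> omega
      · rintro ⟨h3, h4⟩; apply h1'; rw [if_pos (by omega)]; exact h3
      · rw [← Nat.not_even_iff_odd] at hodd ⊢; tauto
  obtain ⟨a, b, hab, hb, hn, hpar, ha⟩ := hc
  rw [Nat.odd_iff, Nat.even_iff] at hpar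
  obtain ⟨k', hk'⟩ : ∃ k', b + 1 = a + 2 * k' := ⟨(b + 1 - a) / 2, by omega⟩
  refine ⟨k', by omega, ?_⟩
  by_cases hev : Even a
  · left
    refine ⟨by omega, fun n => p (a + n), fun x y hx hy h => ?_, fun n hn => ?_, ?_⟩
    · have := hinj _ _ (by omega) (by omega) h; omega
    · have := hstep (a + n) (by omega)
      rw [alt_add, if_pos hev] at this
      exact this
    · change H.Adj (p (a + (2 * k' - 1))) (p a)
      rw [show a + (2 * k' - 1) = b by omega]; exact ha.symm
  · right
    refine ⟨by omega, fun n => p (a + n), fun x y hx hy h => ?_, fun n hn => ?_, ?_⟩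
    · have := hinj _ _ (by omega) (by omega) h; omega
    · have := hstep (a + n) (by omega)
      rw [alt_add, if_neg hev] at this
      exact this
    · change H.Adj (p (a + (2 * k' - 1))) (p a)
      rw [show a + (2 * k' - 1) = b by omega]; exact ha.symm

lemma exists_good_two {W : Type*} [Finite W] {H : SimpleGraph W} (hH : OddChordal H)
    {f f' : W → W} (hf : Mat H f) (hf' : Mat H f') (hne : f ≠ f') :
    Good H f f' 2 ∨ Good H f' f 2 := by
  classical
  have hex : ∃ k, Good H f f' k ∨ Good H f' f k := by
    obtain ⟨k, hk⟩ := exists_good hf hf' hne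
    exact ⟨k, Or.inl hk⟩
  have hs := Nat.find_spec hex
  have hmin : ∀ k < Nat.find hex, ¬ (Good H f f' k ∨ Good H f' f k) :=
    fun k hk => Nat.find_min hex hk
  generalize Nat.find hex = k at hs hmin
  have h2 : 2 ≤ k := by rcases hs with h | h <;> exact h.1
  rcases h2.eq_or_lt with rfl | h3
  · exact hs
  · exfalso
    rcases hs with h | h
    · obtain ⟨k', hk', h'⟩ := good_reduce hH h3 h hf hf'
      exact hmin k' hk' h'
    · obtain ⟨k', hk', h'⟩ := good_reduce hH h3 h hf' hf
      exact hmin k' hk' (Or.symm h')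

lemma ne_symm_iff_aux {W : Type*} (x y : W) : x ≠ y ↔ y ≠ x := ne_comm

/-- disagreement set -/
def disag {W : Type*} (f f' : W → W) : Set W := {x | f x ≠ f' x}

lemma disag_comm {W : Type*} (f f' : W → W) : disag f f' = disag f' f := by
  ext x; exact ne_comm

lemma switch_step {W : Type*} [Finite W] {H : SimpleGraph W} {f f' : W → W} (hf : Mat H f)
    (hf' : Mat H f') (hg : Good H f f' 2) :
    ∃ (g : W → W) (hg : Mat H g), (TransGraph H).Adj (toPM hf) (toPM hg) ∧
      (disag g f').ncard + 2 ≤ (disag f f').ncard ∧ 4 ≤ (disag f f').ncard := by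
  classical
  obtain ⟨_, p, hinj, hstep, hadj⟩ := hg
  have e1 : p 1 = f (p 0) := by simpa [alt] using hstep 0 (by omega)
  have e2 : p 2 = f' (p 1) := by simpa [alt] using hstep 1 (by omega)
  have e3 : p 3 = f (p 2) := by simpa [alt] using hstep 2 (by omega)
  have hadj : H.Adj (p 3) (p 0) := hadj
  have n01 : p 0 ≠ p 1 := fun h => by simpa using hinj _ _ (by omega) (by omega) h
  have n02 : p 0 ≠ p 2 := fun h => by simpa using hinj _ _ (by omega) (by omega) h
  have n03 : p 0 ≠ p 3 := fun h => by simpa using hinj _ _ (by omega) (by omega) h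
  have n12 : p 1 ≠ p 2 := fun h => by simpa using hinj _ _ (by omega) (by omega) h
  have n13 : p 1 ≠ p 3 := fun h => by simpa using hinj _ _ (by omega) (by omega) h
  have n23 : p 2 ≠ p 3 := fun h => by simpa using hinj _ _ (by omega) (by omega) h
  generalize p 0 = x0 at *
  generalize p 1 = x1 at *
  generalize p 2 = x2 at *
  generalize p 3 = x3 at *
  clear hinj hstep
  have f1 : f x1 = x0 := by rw [e1, hf.1]
  have f3 : f x3 = x2 := by rw [e3, hf.1]
  have f2' : f' x2 = x1 := by rw [e2, hf'.1]
  set g : W → W := fun x => if x = x0 then x3 else if x = x3 then x0 else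
    if x = x1 then x2 else if x = x2 then x1 else f x with hgdef
  have g0 : g x0 = x3 := by simp [g]
  have g3 : g x3 = x0 := by simp [g, n03.symm]
  have g1 : g x1 = x2 := by simp [g, n01.symm, n13]
  have g2 : g x2 = x1 := by simp [g, n02.symm, n23, n12.symm]
  have gel : ∀ x, x ≠ x0 → x ≠ x1 → x ≠ x2 → x ≠ x3 → g x = f x := by
    intro x a b c d; simp [g, a, b, c, d]
  clear_value g
  have hcases : ∀ x, x = x0 ∨ x = x1 ∨ x = x2 ∨ x = x3 ∨
      (x ≠ x0 ∧ x ≠ x1 ∧ x ≠ x2 ∧ x ≠ x3) := by intro x; tauto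
  have hgm : Mat H g := by
    constructor
    · intro x
      rcases hcases x with rfl | rfl | rfl | rfl | ⟨a, b, c, d⟩
      · rw [g0, g3]
      · rw [g1, g2]
      · rw [g2, g1]
      · rw [g3, g0]
      · rw [gel x a b c d, gel, hf.1]
        · intro h; apply b; rw [e1, ← h, hf.1]
        · intro h; apply a; rw [← f1, ← h, hf.1]
        · intro h; apply d; rw [e3, ← h, hf.1]
        · intro h; apply c; rw [← f3, ← h, hf.1]
    · intro x
      rcases hcases x with rfl | rfl | rfl | rfl | ⟨a, b, c, d⟩
      · rw [g0]; exact hadj.symm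
      · rw [g1, e2]; exact hf'.2 _
      · rw [g2, ← f2']; exact hf'.2 _
      · rw [g3]; exact hadj
      · rw [gel x a b c d]; exact hf.2 _
  refine ⟨g, hgm, ⟨?_, Or.inl ?_⟩, ?_, ?_⟩
  · intro h
    have h : edgesOf f = edgesOf g := congrArg Subtype.val h
    have h1 : s(x0, x1) ∈ edgesOf f := (mem_edgesOf hf _ _).2 e1.symm
    rw [h, mem_edgesOf hgm, g0] at h1
    exact n13 h1.symm
  · refine ⟨x0, x1, x2, x3, n01, n02, n03, n12, n13, n23, (mem_edgesOf hf _ _).2 e1.symm,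
      (mem_edgesOf hf _ _).2 e3.symm, ?_, hadj.symm, ?_⟩
    · rw [← f2']; exact hf'.2 _
    · change edgesOf g = edgesOf f \ _ ∪ _
      ext e
      induction e using Sym2.ind with
      | _ x y =>
        simp only [Set.mem_union, Set.mem_sdiff, Set.mem_insert_iff, Set.mem_singleton_iff,
          mem_edgesOf hf, mem_edgesOf hgm, Sym2.eq_iff]
        rcases hcases x with rfl | rfl | rfl | rfl | ⟨a, b, c, d⟩
        · rw [g0]; grind
        · rw [g1]; grind
        · rw [g2]; grind
        · rw [g3]; grind
        · rw [gel x a b c d]; grind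
  · have hsub : disag g f' ⊆ disag f f' \ {x1, x2} := by
      intro x hx
      have hx : g x ≠ f' x := hx
      refine ⟨?_, ?_⟩
      · change f x ≠ f' x
        have := hf'.1 x
        grind
      · rintro (rfl | rfl)
        · exact hx (by rw [g1, e2])
        · exact hx (by rw [g2, f2'])
    have h12 : ({x1, x2} : Set W) ⊆ disag f f' := by
      rintro x (rfl | rfl)
      · change f x ≠ f' x; rw [f1, ← e2]; exact n02
      · change f x ≠ f' x; rw [← e3, f2']; exact n13.symm
    have h1 := Set.ncard_le_ncard hsub (Set.toFinite _)
    have h2 := Set.ncard_sdiff_add_ncard_of_subset h12 (Set.toFinite _)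
    rw [Set.ncard_pair n12] at h2
    omega
  · have hs : (({x0, x1, x2, x3} : Finset W) : Set W) ⊆ disag f f' := by
      intro x hx
      simp only [Finset.coe_insert, Finset.coe_singleton, Set.mem_insert_iff,
        Set.mem_singleton_iff] at hx
      change f x ≠ f' x
      have := hf'.1 x
      rcases hx with rfl | rfl | rfl | rfl <;> grind
    have := Set.ncard_le_ncard hs (Set.toFinite _)
    rw [Set.ncard_coe_finset] at this
    have h4 : ({x0, x1, x2, x3} : Finset W).card = 4 := by
      rw [Finset.card_insert_of_notMem, Finset.card_insert_of_notMem,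
        Finset.card_insert_of_notMem, Finset.card_singleton] <;> simp_all
    omega

lemma upper_walk {W : Type*} [Finite W] {H : SimpleGraph W} (hH : OddChordal H) (n : ℕ) :
    ∀ (f f' : W → W) (hf : Mat H f) (hf' : Mat H f'), f ≠ f' → (disag f f').ncard ≤ n →
      ∃ p : (TransGraph H).Walk (toPM hf) (toPM hf'), 2 * (p.length + 1) ≤ (disag f f').ncard := by
  induction n with
  | zero =>
    intro f f' hf hf' hne hc
    obtain ⟨x, hx⟩ := Function.ne_iff.1 hne
    have : 0 < (disag f f').ncard := (Set.ncard_pos (Set.toFinite _)).2 ⟨x, hx⟩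
    omega
  | succ n ih =>
    intro f f' hf hf' hne hc
    rcases exists_good_two hH hf hf' hne with h | h
    · obtain ⟨g, hg, hadj, h1, h2⟩ := switch_step hf hf' h
      by_cases hgf : g = f'
      · subst hgf
        exact ⟨.cons hadj .nil, by simpa using h2⟩
      · obtain ⟨p, hp⟩ := ih g f' hg hf' hgf (by omega)
        exact ⟨.cons hadj p, by rw [SimpleGraph.Walk.length_cons]; omega⟩
    · obtain ⟨g, hg, hadj, h1, h2⟩ := switch_step hf' hf h
      rw [disag_comm f' f, disag_comm g f] at h1
      rw [disag_comm f' f] at h2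
      by_cases hgf : f = g
      · subst hgf
        exact ⟨.cons hadj.symm .nil, by simpa using h2⟩
      · obtain ⟨p, hp⟩ := ih f g hf hg hgf (by omega)
        exact ⟨p.concat hadj.symm, by rw [SimpleGraph.Walk.length_concat]; omega⟩

lemma upper_dist {W : Type*} [Finite W] {H : SimpleGraph W} (hH : OddChordal H) {r : ℕ}
    (hr : 1 ≤ r) (hc : Nat.card W = 2 * r) (M N : {M : Set (Sym2 W) // IsPM H M}) :
    ∃ p : (TransGraph H).Walk M N, p.length ≤ r - 1 := by
  obtain ⟨f, hf, rfl⟩ := exists_mat M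
  obtain ⟨f', hf', rfl⟩ := exists_mat N
  by_cases h : f = f'
  · subst h; exact ⟨.nil, by simp⟩
  · obtain ⟨p, hp⟩ := upper_walk hH _ f f' hf hf' h le_rfl
    have := Set.ncard_le_card (disag f f')
    exact ⟨p, by omega⟩

lemma oddChordal_induce {V : Type*} {G : SimpleGraph V} (hG : OddChordal G) (s : Set V) :
    OddChordal (G.induce s) := by
  intro r hr c hc
  exact hG r hr (fun i => (c i : V))
    ⟨fun i j h => hc.1 (Subtype.ext h), fun i => hc.2 i⟩

lemma even_succ {r : ℕ} (hr : 0 < r) (i : ZMod (2 * r)) : Even (i + 1).val ↔ ¬ Even i.val := by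
  rw [val_succ hr]
  split_ifs with h
  · have : ¬ Even i.val := by rw [Nat.even_iff]; omega
    simp [this]
  · exact Nat.even_add_one

lemma even_pred {r : ℕ} (hr : 0 < r) (i : ZMod (2 * r)) : Even (i - 1).val ↔ ¬ Even i.val := by
  have := even_succ hr (i - 1)
  rw [sub_add_cancel] at this
  tauto

open Classical in
/-- partner maps of the two matchings of the cycle -/
noncomputable def flip0 {r : ℕ} (i : ZMod (2 * r)) : ZMod (2 * r) :=
  if Even i.val then i + 1 else i - 1

open Classical in
/-- partner maps of the two matchings of the cycle -/
noncomputable def flip1 {r : ℕ} (i : ZMod (2 * r)) : ZMod (2 * r) :=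
  if Even i.val then i - 1 else i + 1

lemma exists_pm {W : Type*} {H : SimpleGraph W} {r : ℕ} {c : ZMod (2 * r) → W}
    (hb : Function.Bijective c) {h : ZMod (2 * r) → ZMod (2 * r)} (h1 : ∀ i, h (h i) = i)
    (h2 : ∀ i, H.Adj (c i) (c (h i))) :
    ∃ M : {M : Set (Sym2 W) // IsPM H M}, ∀ i j, s(c i, c j) ∈ M.1 ↔ h i = j := by
  let e := Equiv.ofBijective c hb
  have he : ∀ i, e.symm (c i) = i := fun i => e.symm_apply_apply i
  have hm : Mat H (fun x => c (h (e.symm x))) := by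
    constructor
    · intro x
      obtain ⟨i, rfl⟩ := hb.2 x
      simp only [he, h1]
    · intro x
      obtain ⟨i, rfl⟩ := hb.2 x
      simp only [he, h2]
  refine ⟨toPM hm, fun i j => ?_⟩
  change s(c i, c j) ∈ edgesOf _ ↔ _
  rw [mem_edgesOf hm]
  simp only [he]
  exact hb.1.eq_iff

lemma exists_pm0 {W : Type*} {H : SimpleGraph W} {r : ℕ} (hr : 0 < r) {c : ZMod (2 * r) → W}
    (hb : Function.Bijective c) (hc : IsCycleEmb H c) :
    ∃ M : {M : Set (Sym2 W) // IsPM H M}, ∀ i j, s(c i, c j) ∈ M.1 ↔ flip0 i = j := by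
  apply exists_pm hb
  · intro i
    by_cases h : Even i.val
    · simp [flip0, h, even_succ hr]
    · simp [flip0, h, even_pred hr]
  · intro i
    unfold flip0
    split_ifs
    · exact hc.2 i
    · have := hc.2 (i - 1)
      rw [sub_add_cancel] at this
      exact this.symm

lemma exists_pm1 {W : Type*} {H : SimpleGraph W} {r : ℕ} (hr : 0 < r) {c : ZMod (2 * r) → W}
    (hb : Function.Bijective c) (hc : IsCycleEmb H c) :
    ∃ M : {M : Set (Sym2 W) // IsPM H M}, ∀ i j, s(c i, c j) ∈ M.1 ↔ flip1 i = j := by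
  apply exists_pm hb
  · intro i
    by_cases h : Even i.val
    · simp [flip1, h, even_pred hr]
    · simp [flip1, h, even_succ hr]
  · intro i
    unfold flip1
    split_ifs
    · have := hc.2 (i - 1)
      rw [sub_add_cancel] at this
      exact this.symm
    · exact hc.2 i

/-- arcs: constancy along consecutive indices -/
lemma arc {r : ℕ} {g : ZMod (2 * r) → ℕ} (a : ZMod (2 * r)) (n : ℕ)
    (h : ∀ t < n, g (a + (t : ℕ)) = g (a + (t : ℕ) + 1)) : g a = g (a + (n : ℕ)) := by
  induction n with
  | zero => simp
  | succ n ih =>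
    rw [ih fun t ht => h t (by omega), h n (by omega)]
    push_cast
    rw [add_assoc]

lemma const_of_step {r : ℕ} (hr : 0 < r) {g : ZMod (2 * r) → ℕ} (h : ∀ i, g i = g (i + 1))
    (i j : ZMod (2 * r)) : g i = g j := by
  have : NeZero (2 * r) := ⟨by omega⟩
  have h1 := arc (g := g) i (j - i).val fun t _ => h _
  rw [ZMod.natCast_zmod_val] at h1
  simpa using h1

lemma arc_between {r : ℕ} (hr : 0 < r) {g : ZMod (2 * r) → ℕ} {a b : ZMod (2 * r)}
    (h : ∀ i, i ≠ a → i ≠ b → g i = g (i + 1)) : g (a + 1) = g b := by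
  have : NeZero (2 * r) := ⟨by omega⟩
  have hlt := ZMod.val_lt (b - (a + 1))
  have hn : a + 1 + (((b - (a + 1)).val : ℕ) : ZMod (2 * r)) = b := by
    rw [ZMod.natCast_zmod_val]; ring
  have h1 := arc (g := g) (a + 1) (b - (a + 1)).val (by
    intro t ht
    apply h
    · intro h0
      have h1 : ((t + 1 : ℕ) : ZMod (2 * r)) = 0 := by
        push_cast
        linear_combination h0
      have := (ZMod.natCast_eq_zero_iff _ _).1 h1
      have := Nat.le_of_dvd (by omega) this
      omega
    · intro h0
      have h1 : ((t : ℕ) : ZMod (2 * r)) = b - (a + 1) := by linear_combination h0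
      have h2 := congrArg ZMod.val h1
      rw [ZMod.val_natCast_of_lt (by omega)] at h2
      omega)
  rw [hn] at h1
  exact h1

/-- A labelling of the vertices of the cycle respecting both matchings is constant. -/
lemma lower_walk {W : Type*} [Finite W] {H : SimpleGraph W} {r : ℕ} (hr : 0 < r)
    {c : ZMod (2 * r) → W} (hb : Function.Bijective c)
    {M0 N : {M : Set (Sym2 W) // IsPM H M}} (h0 : ∀ i j, s(c i, c j) ∈ M0.1 ↔ flip0 i = j)
    (hN : ∀ g : W → ℕ, (∀ i : ZMod (2 * r), Even i.val → g (c i) = g (c (i + 1))) →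
      (∀ u v, s(u, v) ∈ N.1 → g u = g v) → ∀ i, g (c i) = g (c (i + 1)))
    (p : (TransGraph H).Walk N M0) : r ≤ p.length + 1 := by
  have : NeZero (2 * r) := ⟨by omega⟩
  let e := Equiv.ofBijective c hb
  have he : ∀ i, e.symm (c i) = i := fun i => e.symm_apply_apply i
  have key : ∀ i : ZMod (2 * r), Even i.val → i.val / 2 = (i + 1).val / 2 := by
    intro i hi
    rw [val_succ hr]
    rw [Nat.even_iff] at hi
    have hlt := ZMod.val_lt i
    split_ifs <;> omega
  obtain ⟨g, hg, hco, hcard⟩ := label_walk p.reverse (fun x => (e.symm x).val / 2) (by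
    intro u v huv
    obtain ⟨i, rfl⟩ := hb.2 u
    obtain ⟨j, rfl⟩ := hb.2 v
    rw [h0] at huv
    simp only [he]
    unfold flip0 at huv
    split_ifs at huv with h
    · rw [← huv]; exact key i h
    · have := key (i - 1) ((even_pred hr i).2 h)
      rw [sub_add_cancel] at this
      rw [← huv]; exact this.symm)
  have hconst := const_of_step hr (g := fun i => g (c i)) (hN g (fun i hi => hco _ _ (by
    simp only [he]; exact key i hi)) hg)
  have h1 : (Set.range g).ncard ≤ 1 := by
    rw [Set.ncard_le_one (Set.toFinite _)]
    rintro _ ⟨u, rfl⟩ _ ⟨v, rfl⟩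
    obtain ⟨i, rfl⟩ := hb.2 u
    obtain ⟨j, rfl⟩ := hb.2 v
    exact hconst i j
  have h2 : ((Finset.range r : Finset ℕ) : Set ℕ) ⊆
      Set.range (fun x => (e.symm x).val / 2) := by
    intro n hn
    have hn : n < r := by simpa using hn
    refine ⟨c ((2 * n : ℕ) : ZMod (2 * r)), ?_⟩
    simp only [he]
    rw [ZMod.val_natCast_of_lt (by omega)]
    omega
  have h3 := Set.ncard_le_ncard h2 (Set.toFinite _)
  rw [Set.ncard_coe_finset, Finset.card_range] at h3
  rw [SimpleGraph.Walk.length_reverse] at hcard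
  omega

/-- If there is no odd chord, every neighbour of the second cycle matching forms, together with
the first, a connected graph. -/
lemma neighbour_conn {W : Type*} {H : SimpleGraph W} {r : ℕ} (hr : 3 ≤ r)
    {c : ZMod (2 * r) → W} (hb : Function.Bijective c)
    (hno : ¬ HasOddChord H c) {M1 N : {M : Set (Sym2 W) // IsPM H M}}
    (h1 : ∀ i j, s(c i, c j) ∈ M1.1 ↔ flip1 i = j) (hadj : (TransGraph H).Adj M1 N)
    (g : W → ℕ) (hg0 : ∀ i : ZMod (2 * r), Even i.val → g (c i) = g (c (i + 1)))
    (hgN : ∀ u v, s(u, v) ∈ N.1 → g u = g v) : ∀ i, g (c i) = g (c (i + 1)) := by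
  have hr0 : 0 < r := by omega
  obtain ⟨u, v, u', v', n1, n2, n3, n4, n5, n6, m1, m2, a1, a2, e⟩ := isSwitch_of_adj hadj
  -- no parallel switch
  have hX : ∀ a b : ZMod (2 * r), ¬ Even a.val → ¬ Even b.val → a ≠ b →
      H.Adj (c b) (c (a + 1)) → H.Adj (c a) (c (b + 1)) → False := by
    intro a b ha hb' hab h1 h2
    have key : ∀ a b : ZMod (2 * r), ¬ Even a.val → ¬ Even b.val → a ≠ b →
        H.Adj (c b) (c (a + 1)) → b = a + 1 + 1 := by
      intro a b ha hb' hab h1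
      by_contra hne
      refine hno ⟨b, a + 1, h1, fun h => hab (add_right_cancel h), hne, ?_⟩
      rw [odd_val_sub hr0, ← Nat.not_even_iff_odd, even_succ hr0]
      tauto
    have e1 := key a b ha hb' hab h1
    have e2 := key b a hb' ha hab.symm h2
    have h4 : ((4 : ℕ) : ZMod (2 * r)) = 0 := by
      push_cast
      linear_combination (-1 : ZMod (2 * r)) * e1 - e2
    have := Nat.le_of_dvd (by omega) ((ZMod.natCast_eq_zero_iff _ _).1 h4)
    omega
  have hY : ∀ a b : ZMod (2 * r), ¬ Even a.val → ¬ Even b.val →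
      N.1 = (M1.1 \ {s(c a, c (a + 1)), s(c b, c (b + 1))}) ∪
        {s(c a, c b), s(c (a + 1), c (b + 1))} → ∀ i, g (c i) = g (c (i + 1)) := by
    intro a b ha hb' hN
    have gab : g (c a) = g (c b) := hgN _ _ (by rw [hN]; right; simp)
    have gab' : g (c (a + 1)) = g (c (b + 1)) := hgN _ _ (by rw [hN]; right; simp)
    have hrest : ∀ i, i ≠ a → i ≠ b → g (c i) = g (c (i + 1)) := by
      intro i hia hib
      by_cases hi : Even i.val
      · exact hg0 i hi
      · apply hgN
        rw [hN]
        left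
        refine ⟨(h1 _ _).2 (by simp [flip1, hi]), ?_⟩
        simp only [Set.mem_insert_iff, Set.mem_singleton_iff, Sym2.eq_iff, hb.1.eq_iff]
        have hthis : ∀ b : ZMod (2 * r), ¬ Even b.val → i ≠ b + 1 := by
          rintro b hb rfl
          exact hi ((even_succ hr0 b).2 hb)
        have := hthis a ha
        have := hthis b hb'
        tauto
    have k1 := arc_between hr0 (g := fun i => g (c i)) hrest
    have k2 := arc_between hr0 (g := fun i => g (c i)) (a := b) (b := a)
      fun i x y => hrest i y x
    intro i
    by_cases hia : i = a
    · subst hia; rw [gab, k1]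
    by_cases hib : i = b
    · subst hib; rw [← gab, k2]
    exact hrest i hia hib
  obtain ⟨a, rfl⟩ := hb.2 u
  obtain ⟨a', rfl⟩ := hb.2 v
  obtain ⟨b, rfl⟩ := hb.2 u'
  obtain ⟨b', rfl⟩ := hb.2 v'
  have f1 := (h1 _ _).1 m1
  have f2 := (h1 _ _).1 m2
  unfold flip1 at f1 f2
  split_ifs at f1 f2 with p1 p2 p2
  · -- both even: parallel
    have e1 : a = a' + 1 := by rw [← f1]; ring
    have e2 : b = b' + 1 := by rw [← f2]; ring
    exfalso
    subst e1 e2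
    rw [even_succ hr0] at p1 p2
    exact hX a' b' p1 p2 (fun h => n5 (by rw [h])) a2.symm a1.symm
  · have e1 : a = a' + 1 := by rw [← f1]; ring
    subst e1 f2
    rw [even_succ hr0] at p1
    apply hY a' b p1 p2
    rw [e]
    congr 2
    · rw [Sym2.eq_swap]
    · rw [Sym2.eq_swap]
  · have e2 : b = b' + 1 := by rw [← f2]; ring
    subst e2 f1
    rw [even_succ hr0] at p2
    apply hY a b' p1 p2
    rw [e, Set.pair_comm s(c (b' + 1), c (a + 1))]
    congr 2
    · rw [Sym2.eq_swap (a := c (b' + 1))]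
    · rw [Sym2.eq_swap (a := c (b' + 1))]
  · subst f1 f2
    exact (hX a b p1 p2 (fun h => n2 (by rw [h])) a1 a2).elim

lemma card_of_bij {W : Type*} {r : ℕ} {c : ZMod (2 * r) → W}
    (hb : Function.Bijective c) : Nat.card W = 2 * r := by
  rw [← Nat.card_congr (Equiv.ofBijective c hb), Nat.card_zmod]

/-- the forward direction on a spanning cycle -/
lemma forward_aux {W : Type*} [Finite W] {H : SimpleGraph W} (hH : OddChordal H) {r : ℕ}
    (hr : 2 ≤ r) {c : ZMod (2 * r) → W} (hb : Function.Bijective c) (hc : IsCycleEmb H c) :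
    (TransGraph H).Connected ∧ (TransGraph H).diam = r - 1 := by
  have hr0 : 0 < r := by omega
  obtain ⟨M0, h0⟩ := exists_pm0 hr0 hb hc
  obtain ⟨M1, h1⟩ := exists_pm1 hr0 hb hc
  have hup := upper_dist hH (by omega : 1 ≤ r) (card_of_bij hb)
  have hcon : (TransGraph H).Connected :=
    { preconnected := fun M N => (hup M N).elim fun p _ => ⟨p⟩
      nonempty := ⟨M0⟩ }
  refine ⟨hcon, le_antisymm ?_ ?_⟩
  · have : Nonempty {M : Set (Sym2 W) // IsPM H M} := ⟨M0⟩
    obtain ⟨u, v, huv⟩ := (TransGraph H).exists_dist_eq_diam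
    obtain ⟨p, hp⟩ := hup u v
    rw [← huv]
    exact (SimpleGraph.dist_le p).trans hp
  · have : Nonempty {M : Set (Sym2 W) // IsPM H M} := ⟨M0⟩
    have hd := SimpleGraph.dist_le_diam (SimpleGraph.connected_iff_ediam_ne_top.1 hcon)
      (u := M1) (v := M0)
    obtain ⟨p, hp⟩ := hcon.exists_walk_length_eq_dist M1 M0
    have := lower_walk hr0 hb h0 (fun g hg0 hg i => by
      by_cases hi : Even i.val
      · exact hg0 i hi
      · exact hg _ _ ((h1 _ _).2 (by simp [flip1, hi]))) p
    omega

/-- the backward direction on a spanning cycle -/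
lemma backward_aux {W : Type*} [Finite W] {H : SimpleGraph W} {r : ℕ}
    (hr : 3 ≤ r) {c : ZMod (2 * r) → W} (hb : Function.Bijective c) (hc : IsCycleEmb H c)
    (hcon : (TransGraph H).Connected) (hdiam : (TransGraph H).diam = r - 1) :
    HasOddChord H c := by
  by_contra hno
  have hr0 : 0 < r := by omega
  obtain ⟨M0, h0⟩ := exists_pm0 hr0 hb hc
  obtain ⟨M1, h1⟩ := exists_pm1 hr0 hb hc
  have : Nonempty {M : Set (Sym2 W) // IsPM H M} := ⟨M0⟩
  have hd := SimpleGraph.dist_le_diam (SimpleGraph.connected_iff_ediam_ne_top.1 hcon)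
    (u := M1) (v := M0)
  obtain ⟨p, hp⟩ := hcon.exists_walk_length_eq_dist M1 M0
  have hlow := lower_walk hr0 hb h0 (fun g hg0 hg i => by
      by_cases hi : Even i.val
      · exact hg0 i hi
      · exact hg _ _ ((h1 _ _).2 (by simp [flip1, hi]))) p
  cases p with
  | nil => simp at hlow; omega
  | cons h q =>
    have := lower_walk hr0 hb h0 (neighbour_conn hr hb hno h1 h) q
    rw [SimpleGraph.Walk.length_cons] at hp
    omega

/-- `G` is odd chordal iff for every even cycle `C` in `G`
(of length `2 * r ≥ 4`), the transition graph of the subgraph induced by the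
vertices of `C` is connected with diameter exactly `|C| / 2 - 1 = r - 1`. -/
theorem oddChordal_iff_transGraph_diam {V : Type*} [Fintype V] (G : SimpleGraph V) :
    OddChordal G ↔
      ∀ r : ℕ, 2 ≤ r → ∀ c : ZMod (2 * r) → V, IsCycleEmb G c →
        (TransGraph (G.induce (Set.range c))).Connected ∧
          (TransGraph (G.induce (Set.range c))).diam = r - 1 := by
  have hbij : ∀ (r : ℕ) (c : ZMod (2 * r) → V), IsCycleEmb G c →
      Function.Bijective (Set.rangeFactorization c) ∧
        IsCycleEmb (G.induce (Set.range c)) (Set.rangeFactorization c) := by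
    intro r c hc
    have hinj : Function.Injective (Set.rangeFactorization c) :=
      fun i j h => hc.1 (congrArg Subtype.val h)
    exact ⟨⟨hinj, Set.rangeFactorization_surjective⟩, hinj, fun i => hc.2 i⟩
  constructor
  · intro hG r hr c hc
    obtain ⟨h1, h2⟩ := hbij r c hc
    exact forward_aux (oddChordal_induce hG _) hr h1 h2
  · intro h r hr c hc
    obtain ⟨h1, h2⟩ := hbij r c hc
    obtain ⟨h3, h4⟩ := h r (by omega) c hc
    have h5 : HasOddChord (G.induce (Set.range c)) (Set.rangeFactorization c) :=
      backward_aux hr h1 h2 h3 h4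
    exact h5
end

section
/- If G is an odd chordal graph on n vertices, then any two perfect matchings of G are at distance at most n/2 − 1 in the transition graph 𝒢(G); in particular, if G has a perfect matching then 𝒢(G) is connected with diameter at most n/2 − 1. -/
/-- `f` encodes a perfect matching: a partner function. -/
def PMFun {V : Type*} (G : SimpleGraph V) (f : V → V) : Prop :=
  (∀ v, f (f v) = v) ∧ ∀ v, G.Adj v (f v)

open Classical in
/-- The vertices where two partner functions differ. -/
noncomputable def DiffSet {V : Type*} [Fintype V] (f g : V → V) : Finset V :=
  Finset.univ.filter fun v => f v ≠ g v

theorem mem_DiffSet {V : Type*} [Fintype V] {f g : V → V} {v : V} :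
    v ∈ DiffSet f g ↔ f v ≠ g v := by
  classical
  simp [DiffSet]

theorem exists_cycle_seq {V : Type*} [Finite V] (f g : V → V) (hf : ∀ v, f (f v) = v)
    (hg : ∀ v, g (g v) = v) (hf0 : ∀ v, f v ≠ v) (hg0 : ∀ v, g v ≠ v) (v : V) :
    ∃ r : ℕ, 0 < r ∧ ∃ c : ℕ → V, c 0 = v ∧ (∀ k, f (c (2 * k)) = c (2 * k + 1)) ∧
      (∀ k, g (c (2 * k + 1)) = c (2 * k + 2)) ∧
      (∀ a b, c a = c b ↔ a % (2 * r) = b % (2 * r)) := by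
  have hfi : Function.Injective f := Function.LeftInverse.injective hf
  have hgi : Function.Injective g := Function.LeftInverse.injective hg
  have hinj : Function.Injective (g ∘ f) := hgi.comp hfi
  set σ := g ∘ f with hσ
  have hper := hinj.mem_periodicPts v
  have hr := Function.minimalPeriod_pos_of_mem_periodicPts hper
  set r := Function.minimalPeriod σ v with hrdef
  obtain ⟨c, hc⟩ : ∃ c : ℕ → V, c = fun n => if n % 2 = 0 then σ^[n / 2] v else f (σ^[n / 2] v) :=
    ⟨_, rfl⟩
  have he : ∀ k, c (2 * k) = σ^[k] v := by
    intro k; simp [hc]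
  have ho : ∀ k, c (2 * k + 1) = f (σ^[k] v) := by
    intro k
    have : (2 * k + 1) / 2 = k := by omega
    simp [hc, this]
  have h1 : ∀ k, f (c (2 * k)) = c (2 * k + 1) := by
    intro k; rw [he, ho]
  have h2 : ∀ k, g (c (2 * k + 1)) = c (2 * k + 2) := by
    intro k
    rw [ho, show 2 * k + 2 = 2 * (k + 1) by ring, he, Function.iterate_succ_apply']
    rfl
  have h1' : ∀ k, f (c (2 * k + 1)) = c (2 * k) := fun k => by rw [← h1, hf]
  have h2' : ∀ k, g (c (2 * k + 2)) = c (2 * k + 1) := fun k => by rw [← h2, hg]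
  have hpar : ∀ d a, c a ≠ c (a + 2 * d + 1) := by
    intro d
    induction d with
    | zero =>
      intro a h
      rcases Nat.even_or_odd' a with ⟨k, rfl | rfl⟩
      · exact hf0 _ ((h1 k).trans h.symm)
      · exact hg0 _ ((h2 k).trans h.symm)
    | succ d ih =>
      intro a h
      apply ih (a + 1)
      rcases Nat.even_or_odd' a with ⟨k, rfl | rfl⟩
      · have := congrArg f h
        rw [h1, show 2 * k + 2 * (d + 1) + 1 = 2 * (k + d + 1) + 1 by ring, h1'] at this
        rw [this]; congr 1; ring
      · have := congrArg g h
        rw [h2, show 2 * k + 1 + 2 * (d + 1) + 1 = 2 * (k + d + 1) + 2 by ring, h2'] at this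
        rw [this]; congr 1; ring
  have hit : ∀ k l, σ^[k] v = σ^[l] v ↔ k % r = l % r := by
    intro k l
    rw [← Function.iterate_mod_minimalPeriod_eq (n := k),
      ← Function.iterate_mod_minimalPeriod_eq (n := l)]
    exact Function.iterate_injOn_Iio_minimalPeriod.eq_iff (Nat.mod_lt _ hr) (Nat.mod_lt _ hr)
  have hmod : ∀ k, (2 * k) % (2 * r) = 2 * (k % r) := fun k => Nat.mul_mod_mul_left 2 k r
  have hmod1 : ∀ k, (2 * k + 1) % (2 * r) = 2 * (k % r) + 1 := by
    intro k
    have h3 := Nat.div_add_mod k r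
    have h4 := Nat.mod_lt k hr
    have : 2 * k + 1 = 2 * (k % r) + 1 + (2 * r) * (k / r) := by nlinarith
    rw [this, Nat.add_mul_mod_self_left, Nat.mod_eq_of_lt (by omega)]
  refine ⟨r, hr, c, by simp [hc], h1, h2, ?_⟩
  intro a b
  rcases Nat.even_or_odd' a with ⟨k, rfl | rfl⟩ <;> rcases Nat.even_or_odd' b with ⟨l, rfl | rfl⟩
  · rw [he, he, hit, hmod, hmod]; omega
  · rw [hmod, hmod1]
    refine ⟨fun h => ?_, fun h => by omega⟩
    exfalso
    rcases le_or_gt k l with hkl | hkl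
    · apply hpar (l - k) (2 * k); rw [h]; congr 1; omega
    · apply hpar (k - l - 1) (2 * l + 1); rw [← h]; congr 1; omega
  · rw [hmod, hmod1]
    refine ⟨fun h => ?_, fun h => by omega⟩
    exfalso
    rcases le_or_gt l k with hkl | hkl
    · apply hpar (k - l) (2 * l); rw [← h]; congr 1; omega
    · apply hpar (l - k - 1) (2 * k + 1); rw [h]; congr 1; omega
  · rw [ho, ho, hfi.eq_iff, hit, hmod1, hmod1]; omega

/-- The intermediate matching exists with suitable bounds. -/
def MidOK {V : Type*} [Fintype V] (G : SimpleGraph V) (f g h : V → V) : Prop :=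
  PMFun G h ∧ f ≠ h ∧ h ≠ g ∧
    (DiffSet f h).card + (DiffSet h g).card ≤ (DiffSet f g).card + 2 ∧
    (DiffSet f h).card < (DiffSet f g).card ∧ (DiffSet h g).card < (DiffSet f g).card

theorem midA {V : Type*} [Fintype V] {G : SimpleGraph V} {f g : V → V}
    (hf : PMFun G f) (hg : PMFun G g) (S : Finset V) (hSD : S ⊆ DiffSet f g)
    (hSf : ∀ v ∈ S, f v ∈ S) (hSg : ∀ v ∈ S, g v ∈ S)
    (x : V) (hx : x ∈ S) (y : V) (hy : y ∈ DiffSet f g) (hyS : y ∉ S) :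
    ∃ h, MidOK G f g h := by
  classical
  obtain ⟨h, hh⟩ : ∃ h : V → V, h = fun v => if v ∈ S then g v else f v := ⟨_, rfl⟩
  have hin : ∀ v ∈ S, h v = g v := fun v hv => by simp [hh, hv]
  have hout : ∀ v, v ∉ S → h v = f v := fun v hv => by simp [hh, hv]
  have hnf : ∀ v, v ∉ S → f v ∉ S := fun v hv hv' => hv (by simpa [hf.1] using hSf _ hv')
  have hxD := mem_DiffSet.1 (hSD hx)
  have hyD := mem_DiffSet.1 hy
  have hD1 : DiffSet f h ⊆ S := by
    intro v hv
    by_contra hvS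
    exact mem_DiffSet.1 hv (hout v hvS).symm
  have hD2 : DiffSet h g ⊆ DiffSet f g \ S := by
    intro v hv
    have hv' := mem_DiffSet.1 hv
    have hvS : v ∉ S := fun hvS => hv' (hin v hvS)
    rw [hout v hvS] at hv'
    exact Finset.mem_sdiff.2 ⟨mem_DiffSet.2 hv', hvS⟩
  have hc1 := Finset.card_le_card hD1
  have hc2 := Finset.card_le_card hD2
  have hc3 := Finset.card_sdiff_add_card_eq_card hSD
  have hc4 : 0 < (DiffSet f g \ S).card :=
    Finset.card_pos.2 ⟨y, Finset.mem_sdiff.2 ⟨hy, hyS⟩⟩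
  have hc5 : 0 < S.card := Finset.card_pos.2 ⟨x, hx⟩
  refine ⟨h, ⟨fun v => ?_, fun v => ?_⟩, ?_, ?_, by omega, by omega, by omega⟩
  · by_cases hv : v ∈ S
    · rw [hin v hv, hin _ (hSg v hv), hg.1]
    · rw [hout v hv, hout _ (hnf v hv), hf.1]
  · by_cases hv : v ∈ S
    · rw [hin v hv]; exact hg.2 v
    · rw [hout v hv]; exact hf.2 v
  · rintro rfl; exact hxD (hin x hx)
  · rintro rfl; exact hyD (hout y hyS).symm

theorem midB {V : Type*} [Fintype V] {G : SimpleGraph V} {f g : V → V}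
    (hf : PMFun G f) (hg : PMFun G g) (S : Finset V) (hSD : S ⊆ DiffSet f g)
    (p q : V) (hp : p ∈ S) (hq : q ∈ S) (hpq : G.Adj p q)
    (hSf : ∀ v ∈ S, f v ∈ S)
    (hSg : ∀ v ∈ S, v ≠ p → v ≠ q → g v ∈ S ∧ g v ≠ p ∧ g v ≠ q)
    (x : V) (hx : x ∈ S) (hxp : x ≠ p) (hxq : x ≠ q)
    (y : V) (hy : y ∈ DiffSet f g) (hyS : y ∉ S) :
    ∃ h, MidOK G f g h := by
  classical
  have hpq' : p ≠ q := hpq.ne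
  obtain ⟨h, hh⟩ : ∃ h : V → V, h = fun v => if v = p then q else if v = q then p else
    if v ∈ S then g v else f v := ⟨_, rfl⟩
  have hhp : h p = q := by simp [hh]
  have hhq : h q = p := by simp [hh]
  have hin : ∀ v ∈ S, v ≠ p → v ≠ q → h v = g v := fun v hv h1 h2 => by simp [hh, hv, h1, h2]
  have hout : ∀ v, v ∉ S → h v = f v := fun v hv => by
    have h1 : v ≠ p := fun h => hv (h ▸ hp)
    have h2 : v ≠ q := fun h => hv (h ▸ hq)
    simp [hh, hv, h1, h2]
  have hnf : ∀ v, v ∉ S → f v ∉ S := fun v hv hv' => hv (by simpa [hf.1] using hSf _ hv')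
  have hxD := mem_DiffSet.1 (hSD hx)
  have hyD := mem_DiffSet.1 hy
  have hD1 : DiffSet f h ⊆ S := by
    intro v hv
    by_contra hvS
    exact mem_DiffSet.1 hv (hout v hvS).symm
  have hD2 : DiffSet h g ⊆ (DiffSet f g \ S) ∪ {p, q} := by
    intro v hv
    have hv' := mem_DiffSet.1 hv
    by_cases h1 : v = p
    · simp [h1]
    by_cases h2 : v = q
    · simp [h2]
    have hvS : v ∉ S := fun hvS => hv' (hin v hvS h1 h2)
    rw [hout v hvS] at hv'
    exact Finset.mem_union_left _ (Finset.mem_sdiff.2 ⟨mem_DiffSet.2 hv', hvS⟩)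
  have hc1 := Finset.card_le_card hD1
  have hc2 := (Finset.card_le_card hD2).trans (Finset.card_union_le _ _)
  have hc2' : ({p, q} : Finset V).card = 2 := Finset.card_pair hpq'
  have hc3 := Finset.card_sdiff_add_card_eq_card hSD
  have hc4 : 0 < (DiffSet f g \ S).card :=
    Finset.card_pos.2 ⟨y, Finset.mem_sdiff.2 ⟨hy, hyS⟩⟩
  have hc5 : 3 ≤ S.card := by
    have : ({x, p, q} : Finset V).card = 3 := Finset.card_eq_three.2 ⟨x, p, q, hxp, hxq, hpq', rfl⟩
    rw [← this]
    apply Finset.card_le_card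
    intro v hv
    simp only [Finset.mem_insert, Finset.mem_singleton] at hv
    rcases hv with rfl | rfl | rfl <;> assumption
  refine ⟨h, ⟨fun v => ?_, fun v => ?_⟩, ?_, ?_, by omega, by omega, by omega⟩
  · by_cases h1 : v = p
    · rw [h1, hhp, hhq]
    by_cases h2 : v = q
    · rw [h2, hhq, hhp]
    by_cases hv : v ∈ S
    · obtain ⟨h3, h4, h5⟩ := hSg v hv h1 h2
      rw [hin v hv h1 h2, hin _ h3 h4 h5, hg.1]
    · rw [hout v hv, hout _ (hnf v hv), hf.1]
  · by_cases h1 : v = p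
    · rw [h1, hhp]; exact hpq
    by_cases h2 : v = q
    · rw [h2, hhq]; exact hpq.symm
    by_cases hv : v ∈ S
    · rw [hin v hv h1 h2]; exact hg.2 v
    · rw [hout v hv]; exact hf.2 v
  · rintro rfl; exact hxD (hin x hx hxp hxq)
  · rintro rfl; exact hyD (hout y hyS).symm

theorem DiffSet_closed {V : Type*} [Fintype V] {f g : V → V}
    (hf : ∀ v, f (f v) = v) (hg : ∀ v, g (g v) = v) {v : V} (hv : v ∈ DiffSet f g) :
    f v ∈ DiffSet f g ∧ g v ∈ DiffSet f g := by
  rw [mem_DiffSet] at *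
  rw [mem_DiffSet]
  constructor
  · intro h
    apply hv
    rw [hf] at h
    have := congrArg g h
    rw [hg] at this
    exact this.symm
  · intro h
    apply hv
    rw [hg] at h
    have := congrArg f h
    rw [hf] at this
    exact this.symm

theorem exists_mid {V : Type*} [Fintype V] {G : SimpleGraph V} (hG : OddChordal G) {f g : V → V}
    (hf : PMFun G f) (hg : PMFun G g) (hne : f ≠ g) (hcard : 4 < (DiffSet f g).card) :
    ∃ h, MidOK G f g h := by
  classical
  obtain ⟨v, hv⟩ := Function.ne_iff.1 hne
  obtain ⟨r, hr, c, hc0, h1, h2, hc⟩ := exists_cycle_seq f g hf.1 hg.1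
    (fun v => (hf.2 v).ne') (fun v => (hg.2 v).ne') v
  have h1' : ∀ k, f (c (2 * k + 1)) = c (2 * k) := fun k => by rw [← h1, hf.1]
  have h2' : ∀ k, g (c (2 * k + 2)) = c (2 * k + 1) := fun k => by rw [← h2, hg.1]
  have hcD : ∀ n, c n ∈ DiffSet f g := by
    intro n
    induction n with
    | zero => rw [hc0]; exact mem_DiffSet.2 hv
    | succ n ih =>
      rcases Nat.even_or_odd' n with ⟨k, rfl | rfl⟩
      · rw [← h1]; exact (DiffSet_closed hf.1 hg.1 ih).1
      · rw [show 2 * k + 1 + 1 = 2 * k + 2 by ring, ← h2]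
        exact (DiffSet_closed hf.1 hg.1 ih).2
  have hcmod : ∀ n, c (n % (2 * r)) = c n := fun n => by rw [hc, Nat.mod_mod]
  have hgc : ∀ n, ∃ m, g (c n) = c m := by
    intro n
    rcases Nat.even_or_odd' n with ⟨k, rfl | rfl⟩
    · refine ⟨2 * (k + r - 1) + 1, ?_⟩
      rw [← h2', show 2 * (k + r - 1) + 2 = 2 * k + 2 * r by omega]
      congr 1
      rw [hc]; simp
    · exact ⟨_, h2 k⟩
  set T : Finset V := (Finset.range (2 * r)).image c with hT
  have hTmem : ∀ n, c n ∈ T := fun n =>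
    Finset.mem_image.2 ⟨n % (2 * r), Finset.mem_range.2 (Nat.mod_lt _ (by omega)), hcmod n⟩
  by_cases hex : ∃ y ∈ DiffSet f g, y ∉ T
  · obtain ⟨y, hy, hyT⟩ := hex
    refine midA hf hg T ?_ ?_ ?_ (c 0) (hTmem 0) y hy hyT
    · intro w hw
      obtain ⟨n, _, rfl⟩ := Finset.mem_image.1 hw
      exact hcD n
    · intro w hw
      obtain ⟨n, _, rfl⟩ := Finset.mem_image.1 hw
      rcases Nat.even_or_odd' n with ⟨k, rfl | rfl⟩
      · rw [h1]; exact hTmem _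
      · rw [h1']; exact hTmem _
    · intro w hw
      obtain ⟨n, _, rfl⟩ := Finset.mem_image.1 hw
      obtain ⟨m, hm⟩ := hgc n
      rw [hm]; exact hTmem _
  · push Not at hex
    have hr3 : 3 ≤ r := by
      have h3 := Finset.card_le_card (show DiffSet f g ⊆ T from hex)
      have h4 : T.card ≤ 2 * r := by
        simpa using Finset.card_image_le (s := Finset.range (2 * r)) (f := c)
      omega
    have : NeZero (2 * r) := ⟨by omega⟩
    have hadj : ∀ n, G.Adj (c n) (c (n + 1)) := by
      intro n
      rcases Nat.even_or_odd' n with ⟨k, rfl | rfl⟩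
      · rw [← h1]; exact hf.2 _
      · rw [show 2 * k + 1 + 1 = 2 * k + 2 by ring, ← h2]; exact hg.2 _
    have hcyc : IsCycleEmb G (fun i : ZMod (2 * r) => c i.val) := by
      constructor
      · intro i j hij
        have := (hc _ _).1 hij
        rw [Nat.mod_eq_of_lt (ZMod.val_lt i), Nat.mod_eq_of_lt (ZMod.val_lt j)] at this
        exact ZMod.val_injective _ this
      · intro i
        have : c (i + 1).val = c (i.val + 1) := by
          conv_lhs => rw [← ZMod.natCast_zmod_val i, ← Nat.cast_one, ← Nat.cast_add,
            ZMod.val_natCast, hcmod]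
        show G.Adj (c i.val) (c (i + 1).val)
        rw [this]; exact hadj _
    obtain ⟨i, j, hij, hn1, hn2, hodd⟩ := hG r hr3 _ hcyc
    -- choose the chord so that it starts at an even position
    have key : ∃ a d : ℕ, G.Adj (c (2 * a)) (c (2 * a + 2 * d + 1)) ∧ 0 < d ∧ d + 1 < r := by
      have aux : ∀ i j : ZMod (2 * r), G.Adj (c i.val) (c j.val) → j ≠ i + 1 → i ≠ j + 1 →
          Odd (j - i).val → Even i.val →
          ∃ a d : ℕ, G.Adj (c (2 * a)) (c (2 * a + 2 * d + 1)) ∧ 0 < d ∧ d + 1 < r := by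
        intro i j hij hn1 hn2 ⟨d, hd⟩ hev
        obtain ⟨a, ha⟩ := hev.two_dvd
        have hjval : j = ((2 * a + 2 * d + 1 : ℕ) : ZMod (2 * r)) := by
          rw [add_assoc, ← ha, ← hd, Nat.cast_add, ZMod.natCast_zmod_val, ZMod.natCast_zmod_val]
          ring
        have hlt := ZMod.val_lt (j - i)
        refine ⟨a, d, ?_, ?_, ?_⟩
        · have : c j.val = c (2 * a + 2 * d + 1) := by
            rw [hjval, ZMod.val_natCast, hcmod]
          rw [← this, ← ha]; exact hij
        · rcases Nat.eq_zero_or_pos d with rfl | h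
          · exfalso; apply hn1
            have : j - i = 1 := by
              rw [← ZMod.natCast_zmod_val (j - i), hd]; simp
            rw [← this]; ring
          · exact h
        · by_contra hcon
          have hdr : d + 1 = r := by omega
          apply hn2
          have : j - i + 1 = 0 := by
            rw [← ZMod.natCast_zmod_val (j - i), hd, ← Nat.cast_succ,
              show Nat.succ (2 * d + 1) = 2 * r by omega, ZMod.natCast_self]
          linear_combination -this
      rcases Nat.even_or_odd i.val with hev | hod
      · exact aux i j hij hn1 hn2 hodd hev
      · have hji : (j.val) % 2 = (i.val + (j - i).val) % 2 := by
          have : j.val = (i.val + (j - i).val) % (2 * r) := by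
            rw [← ZMod.val_add]; congr 1; ring
          rw [this, Nat.mod_mul_right_mod]
        have hij2 : (i.val) % 2 = (j.val + (i - j).val) % 2 := by
          have : i.val = (j.val + (i - j).val) % (2 * r) := by
            rw [← ZMod.val_add]; congr 1; ring
          rw [this, Nat.mod_mul_right_mod]
        rw [Nat.odd_iff] at hod hodd
        refine aux j i hij.symm hn2 hn1 ?_ ?_
        · rw [Nat.odd_iff]; omega
        · rw [Nat.even_iff]; omega
    obtain ⟨a, d, hchord, hd0, hdr⟩ := key
    -- distinctness inside a window
    have hwin : ∀ m n, m < 2 * r → n < 2 * r → c (2 * a + m) = c (2 * a + n) → m = n := by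
      intro m n hm hn h
      have h3 : (2 * a + m) ≡ (2 * a + n) [MOD 2 * r] := (hc _ _).1 h
      have h4 := Nat.ModEq.add_left_cancel' _ h3
      exact Nat.ModEq.eq_of_lt_of_lt h4 hm hn
    set S : Finset V := (Finset.range (2 * d + 2)).image (fun m => c (2 * a + m)) with hS
    have hSmem : ∀ m, m < 2 * d + 2 → c (2 * a + m) ∈ S := fun m hm =>
      Finset.mem_image.2 ⟨m, Finset.mem_range.2 hm, rfl⟩
    refine midB hf hg S ?_ (c (2 * a)) (c (2 * a + 2 * d + 1)) (hSmem 0 (by omega))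
      (hSmem (2 * d + 1) (by omega)) hchord ?_ ?_ (c (2 * a + 1)) (hSmem 1 (by omega)) ?_ ?_
      (c (2 * a + (2 * d + 2))) (hcD _) ?_
    · intro w hw
      obtain ⟨n, _, rfl⟩ := Finset.mem_image.1 hw
      exact hcD _
    · intro w hw
      obtain ⟨n, hn, rfl⟩ := Finset.mem_image.1 hw
      rw [Finset.mem_range] at hn
      rcases Nat.even_or_odd' n with ⟨k, rfl | rfl⟩
      · have : f (c (2 * a + 2 * k)) = c (2 * a + (2 * k + 1)) := by
          rw [← mul_add, h1]; congr 1; ring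
        simp only [this]
        exact hSmem _ (by omega)
      · have : f (c (2 * a + (2 * k + 1))) = c (2 * a + 2 * k) := by
          rw [← add_assoc, ← mul_add, h1']
        simp only [this]
        exact hSmem _ (by omega)
    · intro w hw hwp hwq
      obtain ⟨n, hn, rfl⟩ := Finset.mem_image.1 hw
      rw [Finset.mem_range] at hn
      have hn0 : n ≠ 0 := by rintro rfl; exact hwp rfl
      have hn1 : n ≠ 2 * d + 1 := by rintro rfl; exact hwq rfl
      have : ∃ m, g (c (2 * a + n)) = c (2 * a + m) ∧ 0 < m ∧ m < 2 * d + 1 := by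
        rcases Nat.even_or_odd' n with ⟨k, rfl | rfl⟩
        · refine ⟨2 * k - 1, ?_, by omega, by omega⟩
          rw [show 2 * a + 2 * k = 2 * (a + k - 1) + 2 by omega, h2']
          congr 1; omega
        · refine ⟨2 * k + 2, ?_, by omega, by omega⟩
          rw [show 2 * a + (2 * k + 1) = 2 * (a + k) + 1 by omega, h2]
          congr 1; omega
      obtain ⟨m, hm, hm0, hm1⟩ := this
      simp only [hm]
      refine ⟨hSmem m (by omega), fun h => ?_, fun h => ?_⟩
      · have := hwin m 0 (by omega) (by omega) h
        omega
      · have := hwin m (2 * d + 1) (by omega) (by omega) h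
        omega
    · intro h
      have := hwin 1 0 (by omega) (by omega) h
      omega
    · intro h
      have := hwin 1 (2 * d + 1) (by omega) (by omega) h
      omega
    · intro h
      obtain ⟨n, hn, h⟩ := Finset.mem_image.1 h
      rw [Finset.mem_range] at hn
      have := hwin n (2 * d + 2) (by omega) (by omega) h
      omega

/-- `f` is the partner function of the perfect matching `M`. -/
def PMRep {V : Type*} (M : Set (Sym2 V)) (f : V → V) : Prop :=
  ∀ v w, s(v, w) ∈ M ↔ f v = w

theorem exists_rep {V : Type*} {G : SimpleGraph V} {M : Set (Sym2 V)} (hM : IsPM G M) :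
    ∃ f, PMFun G f ∧ PMRep M f := by
  obtain ⟨hE, hdisj, hcov⟩ := hM
  have : ∀ v, ∃ w, s(v, w) ∈ M := by
    intro v
    obtain ⟨e, he, hve⟩ := hcov v
    obtain ⟨w, rfl⟩ := Sym2.mem_iff_exists.1 hve
    exact ⟨w, he⟩
  choose f hf using this
  have hrep : PMRep M f := by
    intro v w
    constructor
    · intro h
      by_contra hne
      refine hdisj _ (hf v) _ h ?_ v ⟨by simp, by simp⟩
      intro heq
      exact hne (Sym2.congr_right.1 heq)
    · rintro rfl; exact hf v
  refine ⟨f, ⟨fun v => ?_, fun v => ?_⟩, hrep⟩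
  · rw [← hrep, Sym2.eq_swap]; exact hf v
  · exact hE (hf v)

theorem exists_pm_s3 {V : Type*} {G : SimpleGraph V} {f : V → V} (hf : PMFun G f) :
    ∃ M, IsPM G M ∧ PMRep M f := by
  have hrep : PMRep {e | ∃ v, e = s(v, f v)} f := by
    intro v w
    constructor
    · rintro ⟨x, hx⟩
      rcases Sym2.eq_iff.1 hx with ⟨rfl, rfl⟩ | ⟨rfl, rfl⟩
      · rfl
      · exact hf.1 _
    · rintro rfl; exact ⟨v, rfl⟩
  refine ⟨_, ⟨?_, ?_, ?_⟩, hrep⟩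
  · rintro e ⟨v, rfl⟩; exact hf.2 v
  · rintro e he e' he' hne v ⟨hv, hv'⟩
    obtain ⟨w, rfl⟩ := Sym2.mem_iff_exists.1 hv
    obtain ⟨w', rfl⟩ := Sym2.mem_iff_exists.1 hv'
    apply hne
    rw [← (hrep _ _).1 he, ← (hrep _ _).1 he']
  · intro v; exact ⟨_, ⟨v, rfl⟩, by simp⟩

theorem base_switch {V : Type*} [Fintype V] {G : SimpleGraph V} {f g : V → V}
    (hf : PMFun G f) (hg : PMFun G g) (hne : f ≠ g) {M N : Set (Sym2 V)} (hM : PMRep M f)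
    (hN : PMRep N g) :
    4 ≤ (DiffSet f g).card ∧ ((DiffSet f g).card ≤ 4 → IsSwitch G M N) := by
  classical
  obtain ⟨v, hv⟩ := Function.ne_iff.1 hne
  have hff := hf.1
  have hgg := hg.1
  have hf0 : ∀ v, f v ≠ v := fun v => (hf.2 v).ne'
  have hg0 : ∀ v, g v ≠ v := fun v => (hg.2 v).ne'
  have hvD : v ∈ DiffSet f g := mem_DiffSet.2 hv
  have hfv := (DiffSet_closed hff hgg hvD).1
  have hgv := (DiffSet_closed hff hgg hvD).2
  have hfgv := (DiffSet_closed hff hgg hgv).1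
  have e1 : v ≠ f v := (hf0 v).symm
  have e2 : v ≠ g v := (hg0 v).symm
  have e3 : v ≠ f (g v) := fun h => hv (by have := congrArg f h; rwa [hff] at this)
  have e4 : f v ≠ f (g v) := fun h => e2 (by have := congrArg f h; rwa [hff, hff] at this)
  have e5 : g v ≠ f (g v) := (hf0 _).symm
  have hc : ({v, f v, g v, f (g v)} : Finset V).card = 4 := by
    rw [Finset.card_insert_of_notMem, Finset.card_insert_of_notMem, Finset.card_pair e5]
    · simp [hv, e4]
    · simp [e1, e2, e3]
  have hsub : ({v, f v, g v, f (g v)} : Finset V) ⊆ DiffSet f g := by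
    intro w hw
    simp only [Finset.mem_insert, Finset.mem_singleton] at hw
    rcases hw with rfl | rfl | rfl | rfl <;> assumption
  refine ⟨hc ▸ Finset.card_le_card hsub, fun hle => ?_⟩
  have hD := Finset.eq_of_subset_of_card_le hsub (by omega)
  have hgfv := (DiffSet_closed hff hgg hfv).2
  have hgf : g (f v) = f (g v) := by
    rw [← hD] at hgfv
    simp only [Finset.mem_insert, Finset.mem_singleton] at hgfv
    rcases hgfv with h | h | h | h
    · exact absurd (by have := congrArg g h; rwa [hgg] at this) hv
    · exact absurd h (hg0 _)
    · exact absurd (by have := congrArg g h; rw [hgg, hgg] at this; exact this.symm) e1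
    · exact h
  have hgfg : g (f (g v)) = f v := by rw [← hgf, hgg]
  have hother : ∀ w, w ≠ v → w ≠ f v → w ≠ g v → w ≠ f (g v) → f w = g w := by
    intro w w1 w2 w3 w4
    by_contra hw
    have := mem_DiffSet.2 hw
    rw [← hD] at this
    simp [w1, w2, w3, w4] at this
  refine ⟨v, f v, f (g v), g v, e1, e3, e2, e4, hv, e5.symm, (hM _ _).2 rfl, (hM _ _).2 (hff _),
    ?_, hg.2 v, ?_⟩
  · have := (hg.2 (f v)).symm
    rwa [hgf] at this
  · ext e
    induction e using Sym2.ind with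
    | _ x y =>
      simp only [Set.mem_union, Set.mem_sdiff, Set.mem_insert_iff, Set.mem_singleton_iff, hM x y,
        hN x y, Sym2.eq_iff]
      by_cases x1 : x = v
      · subst x1; grind
      by_cases x2 : x = f v
      · subst x2; grind
      by_cases x3 : x = g v
      · subst x3; grind
      by_cases x4 : x = f (g v)
      · subst x4; grind
      have := hother x x1 x2 x3 x4
      grind

theorem rep_inj {V : Type*} {M N : Set (Sym2 V)} {f : V → V} (hM : PMRep M f) (hN : PMRep N f) :
    M = N := by
  ext e
  induction e using Sym2.ind with
  | _ x y => rw [hM, hN]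

theorem exists_walk {V : Type*} [Fintype V] (G : SimpleGraph V) (hG : OddChordal G) :
    ∀ (k : ℕ) (f g : V → V), PMFun G f → PMFun G g → f ≠ g → (DiffSet f g).card = k →
      ∀ X Y : {M : Set (Sym2 V) // IsPM G M}, PMRep X.1 f → PMRep Y.1 g →
        ∃ w : (TransGraph G).Walk X Y, 2 * (w.length + 1) ≤ k := by
  intro k
  induction k using Nat.strong_induction_on with
  | _ k ih =>
    intro f g hf hg hne hk X Y hX hY
    obtain ⟨hb1, hb2⟩ := base_switch hf hg hne hX hY
    by_cases h4 : (DiffSet f g).card ≤ 4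
    · have hadj : (TransGraph G).Adj X Y := by
        rw [TransGraph, SimpleGraph.fromRel_adj]
        refine ⟨?_, Or.inl (hb2 h4)⟩
        rintro rfl
        apply hne
        funext v
        exact ((hX _ _).1 ((hY v _).2 rfl))
      refine ⟨hadj.toWalk, ?_⟩
      simp; omega
    · obtain ⟨h, hh, hfh, hhg, hsum, hl1, hl2⟩ := exists_mid hG hf hg hne (by omega)
      obtain ⟨Z, hZ, hZr⟩ := exists_pm_s3 hh
      obtain ⟨w1, hw1⟩ := ih _ (hk ▸ hl1) f h hf hh hfh rfl X ⟨Z, hZ⟩ hX hZr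
      obtain ⟨w2, hw2⟩ := ih _ (hk ▸ hl2) h g hh hg hhg rfl ⟨Z, hZ⟩ Y hZr hY
      refine ⟨w1.append w2, ?_⟩
      rw [SimpleGraph.Walk.length_append]
      omega

/-- If `G` is an odd chordal graph on `n` vertices, then any
two perfect matchings of `G` are at distance at most `n / 2 - 1` in the
transition graph; in particular, if `G` has a perfect matching then the
transition graph is connected with diameter at most `n / 2 - 1`. -/
theorem oddChordal_dist_le {V : Type*} [Fintype V] (G : SimpleGraph V)
    (hG : OddChordal G) :
    (∀ X Y : {M : Set (Sym2 V) // IsPM G M},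
        (TransGraph G).Reachable X Y ∧
          (TransGraph G).dist X Y ≤ Fintype.card V / 2 - 1) ∧
      ((∃ M : Set (Sym2 V), IsPM G M) →
        (TransGraph G).Connected ∧ (TransGraph G).diam ≤ Fintype.card V / 2 - 1) := by
  have main : ∀ X Y : {M : Set (Sym2 V) // IsPM G M},
        (TransGraph G).Reachable X Y ∧
          (TransGraph G).dist X Y ≤ Fintype.card V / 2 - 1 := by
    intro X Y
    obtain ⟨f, hf, hX⟩ := exists_rep X.2
    obtain ⟨g, hg, hY⟩ := exists_rep Y.2
    by_cases hne : f = g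
    · subst hne
      have : X = Y := Subtype.ext (rep_inj hX hY)
      subst this
      exact ⟨SimpleGraph.Reachable.refl _, by simp⟩
    · obtain ⟨w, hw⟩ := exists_walk G hG _ f g hf hg hne rfl X Y hX hY
      have h1 := SimpleGraph.dist_le w
      have h2 := Finset.card_le_univ (DiffSet f g)
      exact ⟨⟨w⟩, by omega⟩
  refine ⟨main, ?_⟩
  rintro ⟨M, hM⟩
  have : Nonempty {M : Set (Sym2 V) // IsPM G M} := ⟨⟨M, hM⟩⟩
  refine ⟨⟨fun X Y => (main X Y).1⟩, ?_⟩
  obtain ⟨X, Y, hXY⟩ := (TransGraph G).exists_dist_eq_diam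
  rw [← hXY]
  exact (main X Y).2
end

section
/- Let 𝒞 be a hereditary class of bipartite graphs that is closed under disjoint union. Then 𝒞 equals the class of bipartite graphs in quasi-𝒞; that is, a bipartite graph G belongs to 𝒞 if and only if G belongs to quasi-𝒞. -/
/-- A class of finite simple graphs: a predicate on graphs over every finite
vertex type. -/
def GraphClass : Type 1 := ∀ (V : Type) [Finite V], SimpleGraph V → Prop

/-- `G` is bipartite: its vertex set splits into two independent sets. -/
def IsBipartite {V : Type*} (G : SimpleGraph V) : Prop :=
  ∃ L : Set V, ∀ v w : V, G.Adj v w → ((v ∈ L ∧ w ∉ L) ∨ (w ∈ L ∧ v ∉ L))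

/-- The bipartite graph `G[L:R]` on the vertices of `G` (with `R = Lᶜ`),
keeping exactly the edges of `G` with one endpoint in `L` and one in `R`. -/
def cutGraph {V : Type*} (G : SimpleGraph V) (L : Set V) : SimpleGraph V :=
  SimpleGraph.fromRel fun v w => G.Adj v w ∧ v ∈ L ∧ w ∉ L

/-- The quasi-class of `C`: all graphs `G` such that `G[L:R] ∈ C` for every
bipartition `L, R` of the vertex set of `G`. -/
def Quasi (C : GraphClass) : GraphClass :=
  fun V _ G => ∀ L : Set V, C V (cutGraph G L)

/-- The class `C` is closed under isomorphism. -/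
def IsoClosed (C : GraphClass) : Prop :=
  ∀ (V W : Type) [Finite V] [Finite W] (G : SimpleGraph V) (H : SimpleGraph W),
    Nonempty (G ≃g H) → C V G → C W H

/-- The class `C` is hereditary: closed under isomorphism and under taking
induced subgraphs. -/
def HereditaryClass (C : GraphClass) : Prop :=
  IsoClosed C ∧
    ∀ (V : Type) [Finite V] (G : SimpleGraph V) (U : Set V),
      C V G → C ↥U (G.induce U)

/-- The disjoint union of two graphs. -/
def disjSum {α β : Type*} (G : SimpleGraph α) (H : SimpleGraph β) :
    SimpleGraph (α ⊕ β) :=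
  SimpleGraph.fromRel fun x y =>
    match x, y with
    | Sum.inl a, Sum.inl b => G.Adj a b
    | Sum.inr a, Sum.inr b => H.Adj a b
    | _, _ => False

/-- The class `C` is closed under disjoint union. -/
def ClosedUnderDisjUnion (C : GraphClass) : Prop :=
  ∀ (V W : Type) [Finite V] [Finite W] (G : SimpleGraph V) (H : SimpleGraph W),
    C V G → C W H → C (V ⊕ W) (disjSum G H)

/-- If `C` is a hereditary class of bipartite graphs closed
under disjoint union, then a bipartite graph `G` belongs to `C` if and only if
it belongs to quasi-`C`. -/
theorem mem_iff_mem_quasi_of_bipartite (C : GraphClass)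
    (hbip : ∀ (V : Type) [Finite V] (G : SimpleGraph V), C V G → IsBipartite G)
    (hC : HereditaryClass C) (hdu : ClosedUnderDisjUnion C)
    (V : Type) [Finite V] (G : SimpleGraph V) (hG : IsBipartite G) :
    C V G ↔ Quasi C V G := by
  classical
  obtain ⟨A, hA⟩ := hG
  obtain ⟨hiso, hind⟩ := hC
  constructor
  · intro h L
    let U : Set V := {v | v ∈ A ↔ v ∈ L}
    refine hiso _ _ (disjSum (G.induce U) (G.induce Uᶜ)) _ ⟨⟨Equiv.Set.sumCompl U, ?_⟩⟩
      (hdu _ _ _ _ (hind V G U h) (hind V G Uᶜ h))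
    have key : ∀ v w : V, (cutGraph G L).Adj v w ↔ G.Adj v w ∧ (v ∈ U ↔ w ∈ U) := by
      intro v w
      have h1 := hA v w
      have h2 := G.adj_comm v w
      have h3 : G.Adj v w → v ≠ w := fun h => h.ne
      simp only [cutGraph, SimpleGraph.fromRel_adj, U, Set.mem_ofPred_eq]
      tauto
    rintro (⟨a, ha⟩ | ⟨a, ha⟩) (⟨b, hb⟩ | ⟨b, hb⟩)
    all_goals
      have h2 := G.adj_comm a b
      have h3 : G.Adj a b → a ≠ b := fun h => h.ne
      rw [key]
      try simp only [Set.mem_compl_iff] at ha hb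
      simp [disjSum, SimpleGraph.fromRel_adj, ha, hb]
      try tauto
  · intro h
    have : cutGraph G A = G := by
      ext v w
      have h1 := hA v w
      have h2 := G.adj_comm v w
      have h3 : G.Adj v w → v ≠ w := fun h => h.ne
      simp only [cutGraph, SimpleGraph.fromRel_adj]
      tauto
    rw [← this]
    exact h A
end

section
/- A finite simple graph G is odd chordal if and only if, for every bipartition L, R of the vertex set of G, the bipartite graph G[L:R] is chordal bipartite (i.e., every cycle of length at least 6 in G[L:R] has a chord). Equivalently, quasi-ChordalBipartite = OddChordal. -/
/-- `G` is chordal bipartite: bipartite, and every cycle of length at least 6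
has a chord. -/
def ChordalBipartite {V : Type*} (G : SimpleGraph V) : Prop :=
  IsBipartite G ∧ ∀ m : ℕ, 6 ≤ m → ∀ c : ZMod m → V, IsCycleEmb G c → HasChord G c

lemma cutGraph_adj_iff {V : Type*} (G : SimpleGraph V) (L : Set V) (v w : V) :
    (cutGraph G L).Adj v w ↔ G.Adj v w ∧ (w ∈ L ↔ ¬ v ∈ L) := by
  unfold cutGraph
  rw [SimpleGraph.fromRel_adj]
  have h1 := G.adj_comm v w
  constructor
  · rintro ⟨_, h | h⟩ <;> tauto
  · rintro ⟨h, h'⟩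
    have := h.ne
    tauto

lemma odd_val_iff (r : ℕ) (hr : 3 ≤ r) (x : ZMod (2 * r)) :
    Odd x.val ↔ ZMod.castHom (Dvd.intro r rfl : 2 ∣ 2 * r) (ZMod 2) x = 1 := by
  haveI : NeZero (2 * r) := ⟨by omega⟩
  rw [ZMod.castHom_apply, ← ZMod.natCast_val, ZMod.natCast_eq_one_iff_odd]

lemma alternate {m : ℕ} (p : ZMod m → Prop) (h : ∀ i, p (i + 1) ↔ ¬ p i) (i : ZMod m) (n : ℕ) :
    p (i + n) ↔ (p i ↔ Even n) := by
  induction n with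
  | zero => simp
  | succ k ih =>
    rw [Nat.cast_succ, ← add_assoc, h, ih, Nat.even_add_one]
    tauto

/-- `G` is odd chordal iff `G[L:R]` is chordal bipartite for
every bipartition `L, R` of the vertex set of `G`;
i.e. quasi-ChordalBipartite = OddChordal. -/
theorem quasi_chordalBipartite_iff_oddChordal {V : Type*} [Fintype V] (G : SimpleGraph V) :
    (∀ L : Set V, ChordalBipartite (cutGraph G L)) ↔ OddChordal G := by
  constructor
  · intro H r hr c ⟨hinj, hadj⟩
    have hodd := odd_val_iff r hr
    generalize ZMod.castHom (Dvd.intro r rfl : 2 ∣ 2 * r) (ZMod 2) = φ at hodd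
    have hL : ∀ i, c i ∈ c '' {i | φ i = 0} ↔ φ i = 0 := fun i => hinj.mem_set_image
    have key : ∀ a b : ZMod 2, (b = 0 ↔ ¬ a = 0) ↔ b - a = 1 := by decide
    obtain ⟨i, j, hij, h1, h2⟩ := (H (c '' {i | φ i = 0})).2 (2 * r) (by omega) c
      ⟨hinj, fun i => by
        rw [cutGraph_adj_iff, hL, hL, key]
        exact ⟨hadj i, by simp⟩⟩
    rw [cutGraph_adj_iff, hL, hL, key] at hij
    exact ⟨i, j, hij.1, h1, h2, by rw [hodd, map_sub]; exact hij.2⟩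
  · intro H L
    refine ⟨⟨L, fun v w h => ?_⟩, fun m hm c ⟨hinj, hadj⟩ => ?_⟩
    · rw [cutGraph_adj_iff] at h
      tauto
    · simp only [cutGraph_adj_iff] at hadj
      have alt := alternate (fun i => c i ∈ L) (fun i => (hadj i).2)
      have hev : Even m := by
        have := alt 0 m
        simp only [ZMod.natCast_self, add_zero] at this
        tauto
      obtain ⟨r, rfl⟩ := hev.two_dvd
      haveI : NeZero (2 * r) := ⟨by omega⟩
      obtain ⟨i, j, hij, h1, h2, h3⟩ := H r (by omega) c ⟨hinj, fun i => (hadj i).1⟩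
      refine ⟨i, j, ?_, h1, h2⟩
      rw [cutGraph_adj_iff]
      have := alt i (j - i).val
      rw [ZMod.natCast_zmod_val, add_sub_cancel] at this
      rw [← Nat.not_even_iff_odd] at h3
      tauto
end

section
/- A finite simple graph G has every connected component a chain graph if and only if G is bipartite and P₅-free (contains no induced path on five vertices). -/
/-- `G` is a chain graph: a bipartite graph with a bipartition `(L, Lᶜ)` such
that the neighbourhoods of the vertices of `L` are linearly ordered by
inclusion. -/
def IsChainGraph {V : Type*} (G : SimpleGraph V) : Prop :=
  ∃ L : Set V,
    (∀ v w : V, G.Adj v w → ((v ∈ L ∧ w ∉ L) ∨ (w ∈ L ∧ v ∉ L))) ∧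
    ∀ u ∈ L, ∀ v ∈ L,
      G.neighborSet u ⊆ G.neighborSet v ∨ G.neighborSet v ⊆ G.neighborSet u

/-- Every connected component of `G` is a chain graph. -/
def AllComponentsChain {V : Type*} (G : SimpleGraph V) : Prop :=
  ∀ c : G.ConnectedComponent, IsChainGraph (G.induce c.supp)

/-- `G` contains an induced copy of `H`. -/
def HasInducedCopy {V W : Type*} (G : SimpleGraph V) (H : SimpleGraph W) : Prop :=
  ∃ U : Set V, Nonempty (H ≃g G.induce U)

theorem p5_of_path {V : Type*} (G : SimpleGraph V) (L : Set V)
    (hL : ∀ v w : V, G.Adj v w → ((v ∈ L ∧ w ∉ L) ∨ (w ∈ L ∧ v ∉ L)))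
    (hP : ¬ HasInducedCopy G (SimpleGraph.pathGraph 5)) (a b c d e : V)
    (h1 : G.Adj a b) (h2 : G.Adj b c) (h3 : G.Adj c d) (h4 : G.Adj d e)
    (h5 : ¬ G.Adj a d) (h6 : ¬ G.Adj b e) : False := by
  apply hP
  have n1 : ¬ G.Adj a c := by grind
  have n2 : ¬ G.Adj b d := by grind
  have n3 : ¬ G.Adj c e := by grind
  have n4 : ¬ G.Adj a e := by grind
  have e1 : a ≠ c := by rintro rfl; exact h5 h3
  have e2 : a ≠ e := by rintro rfl; exact h5 h4.symm
  have e3 : c ≠ e := by rintro rfl; exact h6 h2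
  have e4 : b ≠ d := by rintro rfl; exact h5 h1
  have hinj : Function.Injective ![a, b, c, d, e] := by
    intro i j hij
    have m1 := h1.ne
    have m2 := h2.ne
    have m3 := h3.ne
    have m4 := h4.ne
    have m5 : a ≠ d := by rintro rfl; grind
    have m6 : b ≠ e := by rintro rfl; grind
    fin_cases i <;> fin_cases j <;> simp_all
  refine ⟨Set.range ![a, b, c, d, e], ⟨⟨Equiv.ofInjective _ hinj, ?_⟩⟩⟩
  intro i j
  have l : ∀ x, ¬ G.Adj x x := fun x => G.irrefl
  simp only [SimpleGraph.comap_adj, SimpleGraph.pathGraph_adj, Equiv.ofInjective_apply,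
    Function.Embedding.subtype_apply]
  fin_cases i <;> fin_cases j <;> simp_all [G.adj_comm]

theorem reach_cases {V : Type*} (G : SimpleGraph V) (L : Set V)
    (hL : ∀ v w : V, G.Adj v w → ((v ∈ L ∧ w ∉ L) ∨ (w ∈ L ∧ v ∉ L)))
    (hP : ¬ HasInducedCopy G (SimpleGraph.pathGraph 5)) (u v : V) (h : G.Reachable u v) :
    u = v ∨ (∃ x, G.Adj u x ∧ G.Adj x v) ∨ G.Adj u v ∨
      (∃ x y, G.Adj u x ∧ G.Adj x y ∧ G.Adj y v) := by
  rw [SimpleGraph.reachable_iff_reflTransGen] at h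
  induction h with
  | refl => exact Or.inl rfl
  | tail _ hvw ih =>
    rename_i v w _
    rcases ih with rfl | ⟨x, h1, h2⟩ | h | ⟨x, y, h1, h2, h3⟩
    · exact Or.inr (Or.inr (Or.inl hvw))
    · exact Or.inr (Or.inr (Or.inr ⟨x, v, h1, h2, hvw⟩))
    · exact Or.inr (Or.inl ⟨v, h, hvw⟩)
    · by_cases h5 : G.Adj u v
      · exact Or.inr (Or.inl ⟨v, h5, hvw⟩)
      by_cases h6 : G.Adj x w
      · exact Or.inr (Or.inl ⟨x, h1, h6⟩)
      exact (p5_of_path G L hL hP u x y v w h1 h2 h3 hvw h5 h6).elim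

/-- Every connected component of a finite simple graph `G` is
a chain graph if and only if `G` is bipartite and `P₅`-free. -/
theorem allComponentsChain_iff_bipartite_P5_free {V : Type*} [Fintype V]
    (G : SimpleGraph V) :
    AllComponentsChain G ↔
      IsBipartite G ∧ ¬ HasInducedCopy G (SimpleGraph.pathGraph 5) := by
  constructor
  · intro h
    constructor
    · choose L hL _ using h
      refine ⟨{v | (⟨v, rfl⟩ : (G.connectedComponentMk v).supp) ∈ L (G.connectedComponentMk v)}, ?_⟩
      intro v w hvw
      have key : ∀ c (hv : G.connectedComponentMk v = c) (hw : G.connectedComponentMk w = c),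
          ((⟨v, rfl⟩ : (G.connectedComponentMk v).supp) ∈ L (G.connectedComponentMk v) ↔
            (⟨v, hv⟩ : c.supp) ∈ L c) ∧
          ((⟨w, rfl⟩ : (G.connectedComponentMk w).supp) ∈ L (G.connectedComponentMk w) ↔
            (⟨w, hw⟩ : c.supp) ∈ L c) := by
        intro c hv hw
        constructor
        · subst hv; rfl
        · subst hw; rfl
      have hw : G.connectedComponentMk w = G.connectedComponentMk v :=
        (SimpleGraph.ConnectedComponent.eq.2 hvw.reachable).symm
      obtain ⟨k1, k2⟩ := key _ rfl hw
      simp only [Set.mem_setOf_eq]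
      rw [k2]
      exact hL (G.connectedComponentMk v) ⟨v, rfl⟩ ⟨w, hw⟩ hvw
    · rintro ⟨U, ⟨f⟩⟩
      have hf : ∀ i j, G.Adj (f i).1 (f j).1 ↔ (SimpleGraph.pathGraph 5).Adj i j :=
        fun i j => f.map_rel_iff
      simp only [SimpleGraph.pathGraph_adj] at hf
      have h01 : G.Adj (f 0).1 (f 1).1 := (hf 0 1).2 (by simp)
      have h12 : G.Adj (f 1).1 (f 2).1 := (hf 1 2).2 (by simp)
      have h23 : G.Adj (f 2).1 (f 3).1 := (hf 2 3).2 (by simp)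
      have h34 : G.Adj (f 3).1 (f 4).1 := (hf 3 4).2 (by simp)
      have h03 : ¬ G.Adj (f 0).1 (f 3).1 := by rw [hf]; simp
      have h14 : ¬ G.Adj (f 1).1 (f 4).1 := by rw [hf]; simp
      generalize (f 0).1 = a at *
      generalize (f 1).1 = b at *
      generalize (f 2).1 = c at *
      generalize (f 3).1 = d at *
      generalize (f 4).1 = e at *
      obtain ⟨L, hL, hN⟩ := h (G.connectedComponentMk a)
      have rb := h01.reachable
      have rc := rb.trans h12.reachable
      have rd := rc.trans h23.reachable
      have re := rd.trans h34.reachable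
      let S := (G.connectedComponentMk a).supp
      let a' : S := ⟨a, rfl⟩
      let b' : S := ⟨b, SimpleGraph.ConnectedComponent.eq.2 rb.symm⟩
      let c' : S := ⟨c, SimpleGraph.ConnectedComponent.eq.2 rc.symm⟩
      let d' : S := ⟨d, SimpleGraph.ConnectedComponent.eq.2 rd.symm⟩
      let e' : S := ⟨e, SimpleGraph.ConnectedComponent.eq.2 re.symm⟩
      have l1 := hL a' b' h01
      have l2 := hL b' c' h12
      have l3 := hL c' d' h23
      have l4 := hL d' e' h34
      by_cases ha : a' ∈ L
      · have he : e' ∈ L := by tauto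
        rcases hN a' ha e' he with k | k
        · have : G.Adj e b := k (show b' ∈ _ from h01)
          exact h14 this.symm
        · have : G.Adj a d := k (show d' ∈ _ from h34.symm)
          exact h03 this
      · have hb : b' ∈ L := by tauto
        have hd : d' ∈ L := by tauto
        rcases hN b' hb d' hd with k | k
        · have : G.Adj d a := k (show a' ∈ _ from h01.symm)
          exact h03 this.symm
        · have : G.Adj b e := k (show e' ∈ _ from h34)
          exact h14 this
  · rintro ⟨⟨L, hL⟩, hP⟩ c
    refine ⟨{v | v.1 ∈ L}, fun v w h => hL v.1 w.1 h, ?_⟩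
    rintro ⟨u, hu⟩ huL ⟨v, hv⟩ hvL
    by_contra hcon
    rw [not_or, Set.not_subset, Set.not_subset] at hcon
    obtain ⟨⟨⟨a, _⟩, ha1, ha2⟩, ⟨⟨b, _⟩, hb1, hb2⟩⟩ := hcon
    change G.Adj u a at ha1
    change ¬ G.Adj v a at ha2
    change G.Adj v b at hb1
    change ¬ G.Adj u b at hb2
    change u ∈ L at huL
    change v ∈ L at hvL
    have hr : G.Reachable u v := SimpleGraph.ConnectedComponent.eq.1 (hu.trans hv.symm)
    rcases reach_cases G L hL hP u v hr with rfl | ⟨x, h1, h2⟩ | h | ⟨x, y, h1, h2, h3⟩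
    · exact ha2 ha1
    · exact p5_of_path G L hL hP a u x v b ha1.symm h1 h2 hb1 (fun h => ha2 h.symm) hb2
    · grind
    · grind
end

section
/- A finite simple graph G has every connected component a chain graph if and only if G is (triangle, C₅, P₅)-free, i.e., G contains no induced subgraph isomorphic to the triangle K₃, the 5-cycle C₅, or the path P₅ on five vertices. -/
theorem chain_of_walks {V : Type*} (H : SimpleGraph V) (hc : H.Connected)
    (T : ∀ a b c, H.Adj a b → H.Adj b c → ¬ H.Adj a c)
    (K : ∀ a b c d e, H.Adj a b → H.Adj b c → H.Adj c d → H.Adj d e →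
      H.Adj a d ∨ H.Adj b e) : IsChainGraph H := by
  obtain ⟨r⟩ := hc.nonempty
  let L : Set V := {v | v = r ∨ ∃ p, H.Adj r p ∧ H.Adj p v}
  have step : ∀ u v w, u ∈ L → H.Adj u v → H.Adj v w → w ∈ L := by
    rintro u v w (rfl | ⟨p, h1, h2⟩) h3 h4
    · exact Or.inr ⟨v, h3, h4⟩
    · rcases K r p u v w h1 h2 h3 h4 with h | h
      · exact Or.inr ⟨v, h, h4⟩
      · exact Or.inr ⟨p, h1, h⟩
  have cov : ∀ v, v ∈ L ∨ ∃ u ∈ L, H.Adj u v := by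
    intro v
    obtain ⟨p⟩ := hc.preconnected v r
    induction p with
    | nil => exact Or.inl (Or.inl rfl)
    | cons h p ih =>
      rename_i a b c
      rcases ih step with h' | ⟨u, hu, h'⟩
      · exact Or.inr ⟨_, h', h.symm⟩
      · exact Or.inl (step u _ _ hu h' h.symm)
  have ind : ∀ v w, H.Adj v w → v ∈ L → w ∈ L → False := by
    rintro v w h (rfl | ⟨p, h1, h2⟩) (rfl | ⟨q, h3, h4⟩)
    · exact H.irrefl h
    · exact T _ _ _ h3 h4 h
    · exact T _ _ _ h1 h2 h.symm
    · rcases K p v w q r h2 h h4.symm h3.symm with h' | h'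
      · exact T _ _ _ h1 h' h3
      · exact T _ _ _ h1 h2 h'.symm
  refine ⟨L, fun v w h => ?_, fun u hu v hv => ?_⟩
  · by_cases hv : v ∈ L
    · exact Or.inl ⟨hv, fun hw => ind v w h hv hw⟩
    · rcases cov v with h' | ⟨u, hu, h'⟩
      · exact absurd h' hv
      · exact Or.inr ⟨step u v w hu h' h, hv⟩
  · have com : u = v ∨ ∃ p, H.Adj u p ∧ H.Adj p v := by
      rcases hu with rfl | ⟨p, h1, h2⟩
      · rcases hv with rfl | h
        · exact Or.inl rfl
        · exact Or.inr h
      · rcases hv with rfl | ⟨q, h3, h4⟩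
        · exact Or.inr ⟨p, h2.symm, h1.symm⟩
        · rcases K u p r q v h2.symm h1.symm h3 h4 with h | h
          · exact Or.inr ⟨q, h, h4⟩
          · exact Or.inr ⟨p, h2.symm, h⟩
    rcases com with rfl | ⟨p, h1, h2⟩
    · exact Or.inl subset_rfl
    · by_contra hcon
      rw [not_or, Set.not_subset, Set.not_subset] at hcon
      obtain ⟨⟨x, hx, hx'⟩, ⟨y, hy, hy'⟩⟩ := hcon
      rcases K x u p v y (SimpleGraph.Adj.symm hx) h1 h2 hy with h | h
      · exact hx' (SimpleGraph.Adj.symm h)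
      · exact hy' h

theorem hasInducedCopy_iff {V W : Type*} (G : SimpleGraph V) (H : SimpleGraph W) :
    HasInducedCopy G H ↔ ∃ f : W → V, Function.Injective f ∧
      ∀ i j, G.Adj (f i) (f j) ↔ H.Adj i j := by
  constructor
  · rintro ⟨U, ⟨e⟩⟩
    exact ⟨fun i => (e i).1, fun i j h => e.injective (Subtype.ext h),
      fun i j => e.map_adj_iff⟩
  · rintro ⟨f, hf, h⟩
    exact ⟨Set.range f, ⟨⟨Equiv.ofInjective f hf, fun {a b} => h a b⟩⟩⟩

/-- The colouring of a component, pulled back to `V`. -/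
theorem component_data {V : Type*} (G : SimpleGraph V) (h : AllComponentsChain G) (r : V) :
    ∃ L : Set V, (∀ v w, G.Reachable v r → G.Adj v w → (v ∈ L ↔ w ∉ L)) ∧
      ∀ u ∈ L, ∀ v ∈ L, ∀ x y, G.Reachable u r → G.Reachable v r →
        G.Adj u x → G.Adj v y → G.Adj v x ∨ G.Adj u y := by
  obtain ⟨L, h1, h2⟩ := h (G.connectedComponentMk r)
  have mem : ∀ v, G.Reachable v r → v ∈ (G.connectedComponentMk r).supp := fun v hv =>
    SimpleGraph.ConnectedComponent.sound hv
  refine ⟨Set.image Subtype.val L, fun v w hv a => ?_, ?_⟩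
  · have hw : G.Reachable w r := a.symm.reachable.trans hv
    have := h1 ⟨v, mem v hv⟩ ⟨w, mem w hw⟩ a
    have hv' := mem v hv
    have hw' := mem w hw
    simp only [Set.mem_image, Subtype.exists, exists_and_right, exists_eq_right]
    grind
  · rintro _ ⟨u, hu, rfl⟩ _ ⟨v, hv, rfl⟩ x y ru rv a b
    have hx := mem x (a.symm.reachable.trans ru)
    have hy := mem y (b.symm.reachable.trans rv)
    rcases h2 u hu v hv with s | s
    · exact Or.inl (@s ⟨x, hx⟩ a)
    · exact Or.inr (@s ⟨y, hy⟩ b)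

/-- Every connected component of a finite simple graph `G` is
a chain graph if and only if `G` is (`K₃`, `C₅`, `P₅`)-free. -/
theorem allComponentsChain_iff_triangle_C5_P5_free {V : Type*} [Fintype V]
    (G : SimpleGraph V) :
    AllComponentsChain G ↔
      ¬ HasInducedCopy G (⊤ : SimpleGraph (Fin 3)) ∧
      ¬ HasInducedCopy G (SimpleGraph.cycleGraph 5) ∧
      ¬ HasInducedCopy G (SimpleGraph.pathGraph 5) := by
  simp only [hasInducedCopy_iff]
  constructor
  · intro h
    refine ⟨?_, ?_, ?_⟩
    · rintro ⟨f, -, hf⟩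
      obtain ⟨L, h1, -⟩ := component_data G h (f 0)
      have a01 : G.Adj (f 0) (f 1) := (hf 0 1).2 (by decide)
      have a12 : G.Adj (f 1) (f 2) := (hf 1 2).2 (by decide)
      have a02 : G.Adj (f 0) (f 2) := (hf 0 2).2 (by decide)
      have := h1 _ _ (SimpleGraph.Reachable.refl _) a01
      have := h1 _ _ (SimpleGraph.Reachable.refl _) a02
      have := h1 _ _ a01.symm.reachable a12
      tauto
    · rintro ⟨f, -, hf⟩
      obtain ⟨L, h1, -⟩ := component_data G h (f 0)
      have a01 : G.Adj (f 0) (f 1) := (hf 0 1).2 (by decide)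
      have a12 : G.Adj (f 1) (f 2) := (hf 1 2).2 (by decide)
      have a23 : G.Adj (f 2) (f 3) := (hf 2 3).2 (by decide)
      have a34 : G.Adj (f 3) (f 4) := (hf 3 4).2 (by decide)
      have a04 : G.Adj (f 0) (f 4) := (hf 0 4).2 (by decide)
      have r1 := a01.symm.reachable
      have r2 := a12.symm.reachable.trans r1
      have r3 := a23.symm.reachable.trans r2
      have := h1 _ _ (SimpleGraph.Reachable.refl _) a01
      have := h1 _ _ (SimpleGraph.Reachable.refl _) a04
      have := h1 _ _ r1 a12
      have := h1 _ _ r2 a23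
      have := h1 _ _ r3 a34
      tauto
    · rintro ⟨f, -, hf⟩
      obtain ⟨L, h1, h2⟩ := component_data G h (f 0)
      have a01 : G.Adj (f 0) (f 1) := (hf 0 1).2 (by simp [SimpleGraph.pathGraph_adj])
      have a12 : G.Adj (f 1) (f 2) := (hf 1 2).2 (by simp [SimpleGraph.pathGraph_adj])
      have a23 : G.Adj (f 2) (f 3) := (hf 2 3).2 (by simp [SimpleGraph.pathGraph_adj])
      have a34 : G.Adj (f 3) (f 4) := (hf 3 4).2 (by simp [SimpleGraph.pathGraph_adj])
      have n03 : ¬ G.Adj (f 0) (f 3) := fun h => by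
        simpa [SimpleGraph.pathGraph_adj] using (hf 0 3).1 h
      have n14 : ¬ G.Adj (f 1) (f 4) := fun h => by
        simpa [SimpleGraph.pathGraph_adj] using (hf 1 4).1 h
      have r0 := SimpleGraph.Reachable.refl (G := G) (f 0)
      have r1 := a01.symm.reachable
      have r2 := a12.symm.reachable.trans r1
      have r3 := a23.symm.reachable.trans r2
      have r4 := a34.symm.reachable.trans r3
      have c0 := h1 _ _ r0 a01
      have c1 := h1 _ _ r1 a12
      have c2 := h1 _ _ r2 a23
      have c3 := h1 _ _ r3 a34
      by_cases m : f 0 ∈ L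
      · rcases h2 _ m (f 4) (by tauto) _ _ r0 r4 a01 a34.symm with h | h
        · exact n14 h.symm
        · exact n03 h
      · rcases h2 (f 1) (by tauto) (f 3) (by tauto) _ _ r1 r3 a01.symm a34 with h | h
        · exact n03 h.symm
        · exact n14 h
  · rintro ⟨hT, hC, hP⟩ c
    have T : ∀ a b c, G.Adj a b → G.Adj b c → ¬ G.Adj a c := by
      intro a b c h1 h2 h3
      have := h1.ne
      have := h2.ne
      have := h3.ne
      refine hT ⟨![a, b, c], ?_, ?_⟩
      · intro i j
        fin_cases i <;> fin_cases j <;> simp <;> grind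
      · intro i j
        fin_cases i <;> fin_cases j <;> simp [h1, h2, h3, h1.symm, h2.symm, h3.symm]
    have K : ∀ a b c d e, G.Adj a b → G.Adj b c → G.Adj c d → G.Adj d e →
        G.Adj a d ∨ G.Adj b e := by
      intro a b c d e h1 h2 h3 h4
      by_contra hcon
      rw [not_or] at hcon
      obtain ⟨n1, n2⟩ := hcon
      have t1 := T _ _ _ h1 h2
      have t2 := T _ _ _ h2 h3
      have t3 := T _ _ _ h3 h4
      have e1 := h1.ne
      have e2 := h2.ne
      have e3 := h3.ne
      have e4 := h4.ne
      have e5 : a ≠ c := by rintro rfl; exact n1 h3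
      have e6 : b ≠ d := by rintro rfl; exact n2 h4
      have e7 : c ≠ e := by rintro rfl; exact n2 h2
      have e8 : a ≠ d := by rintro rfl; exact t2 h1.symm
      have e9 : b ≠ e := by rintro rfl; exact t2 h4.symm
      have e10 : a ≠ e := by rintro rfl; exact n2 h1.symm
      have inj : Function.Injective ![a, b, c, d, e] := by
        intro i j
        fin_cases i <;> fin_cases j <;> simp <;> grind
      by_cases h5 : G.Adj a e
      · refine hC ⟨![a, b, c, d, e], inj, ?_⟩
        intro i j
        have : (SimpleGraph.cycleGraph 5).Adj i j ↔ (i.val + 1) % 5 = j.val ∨ (j.val + 1) % 5 = i.val := by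
          revert i j; decide
        rw [this]
        fin_cases i <;> fin_cases j <;>
          simp [h1, h2, h3, h4, h5, h1.symm, h2.symm, h3.symm, h4.symm, h5.symm, t1, t2, t3, n1, n2,
            G.adj_comm c a, G.adj_comm d b, G.adj_comm e c, G.adj_comm d a, G.adj_comm e b]
      · refine hP ⟨![a, b, c, d, e], inj, ?_⟩
        intro i j
        rw [SimpleGraph.pathGraph_adj]
        fin_cases i <;> fin_cases j <;>
          simp [h1, h2, h3, h4, h5, h1.symm, h2.symm, h3.symm, h4.symm, t1, t2, t3, n1, n2,
            G.adj_comm c a, G.adj_comm d b, G.adj_comm e c, G.adj_comm d a, G.adj_comm e b,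
            G.adj_comm e a]
    exact chain_of_walks _ c.connected_toSimpleGraph (fun a b c => T a.1 b.1 c.1)
      (fun a b c d e => K a.1 b.1 c.1 d.1 e.1)
end

section
/- Every perfect matching M of the graph G_k satisfies the one-sided property: (a) if the edge x₁x₂ belongs to M, then M = M₀; and (b) it is impossible that M contains edges x₁v₁ and x₂v₂ with one of v₁, v₂ in U ∪ W and the other in Y ∪ Z. Consequently every perfect matching of G_k either equals M₀, or matches both x₁ and x₂ to vertices of U ∪ W, or matches both x₁ and x₂ to vertices of Y ∪ Z. -/
/-- The vertices of the graph `G_k`: `U = {u i}`, `W = {w i}`, `X = {x₁, x₂}`,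
`Y = {y i}`, `Z = {z i}`. -/
inductive GkV (k : ℕ) where
  | u (i : Fin k)
  | w (i : Fin k)
  | x1
  | x2
  | y (i : Fin k)
  | z (i : Fin k)
  deriving DecidableEq

/-- The base relation generating the edges of `G_k`. -/
def GkRel (k : ℕ) : GkV k → GkV k → Prop := fun a b =>
  match a, b with
  | .u i, .w j => i ≤ j
  | .w i, .w j => i ≠ j
  | .y i, .y j => i ≠ j
  | .x1, .x2 => True
  | .x1, .u _ => True
  | .x1, .w _ => True
  | .x2, .u _ => True
  | .x2, .w _ => True
  | .x1, .y _ => True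
  | .x1, .z _ => True
  | .x2, .y _ => True
  | .x2, .z _ => True
  | .z i, .y j => i ≤ j
  | _, _ => False

/-- The graph `G_k`. -/
def Gk (k : ℕ) : SimpleGraph (GkV k) := SimpleGraph.fromRel (GkRel k)

/-- The distinguished perfect matching
`M₀ = {uᵢwᵢ : i} ∪ {yᵢzᵢ : i} ∪ {x₁x₂}` of `G_k`. -/
def GkM0 (k : ℕ) : Set (Sym2 (GkV k)) :=
  {e | ∃ i : Fin k, e = s(GkV.u i, GkV.w i)} ∪
    {e | ∃ i : Fin k, e = s(GkV.y i, GkV.z i)} ∪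
    {s(GkV.x1, GkV.x2)}

/-- The vertex `v` belongs to `U ∪ W`. -/
def InUW {k : ℕ} (v : GkV k) : Prop :=
  (∃ i, v = GkV.u i) ∨ (∃ i, v = GkV.w i)

/-- The vertex `v` belongs to `Y ∪ Z`. -/
def InYZ {k : ℕ} (v : GkV k) : Prop :=
  (∃ i, v = GkV.y i) ∨ (∃ i, v = GkV.z i)

theorem aux_partner {V : Type*} (G : SimpleGraph V) (M : Set (Sym2 V)) (hM : IsPM G M) :
    ∃ f : V → V, (∀ v, G.Adj v (f v)) ∧ (∀ v, f (f v) = v) ∧ (∀ a b, s(a, b) ∈ M ↔ f a = b) := by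
  obtain ⟨h1, h2, h3⟩ := hM
  have h4 : ∀ v, ∃ w, s(v, w) ∈ M := by
    intro v
    obtain ⟨e, he, hv⟩ := h3 v
    obtain ⟨w, rfl⟩ := hv
    exact ⟨w, he⟩
  choose f hf using h4
  have h5 : ∀ a b, s(a, b) ∈ M → f a = b := by
    intro a b hab
    by_contra hne
    refine h2 _ (hf a) _ hab ?_ a ⟨by simp, by simp⟩
    intro h
    exact hne (Sym2.congr_right.mp h)
  refine ⟨f, fun v => h1 (hf v), fun v => h5 _ _ ?_, fun a b => ⟨h5 a b, ?_⟩⟩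
  · rw [Sym2.eq_swap]; exact hf v
  · rintro rfl; exact hf a

theorem aux_id {k : ℕ} (g : Fin k → Fin k) (hg : Function.Injective g) (h : ∀ i, i ≤ g i) :
    ∀ i, g i = i := by
  have hb : Function.Bijective g := Finite.injective_iff_bijective.mp hg
  have hs : ∑ i, (g i : ℕ) = ∑ i : Fin k, (i : ℕ) :=
    hb.sum_comp (fun i : Fin k => (i : ℕ))
  have := (Finset.sum_eq_sum_iff_of_le (s := Finset.univ) (f := fun i : Fin k => (i : ℕ))
    (g := fun i => (g i : ℕ)) (fun i _ => h i)).mp hs.symm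
  intro i
  exact Fin.ext (this i (Finset.mem_univ i)).symm

theorem aux_parity {V : Type*} [DecidableEq V] {k : ℕ} (p q : Fin k → V)
    (hp : Function.Injective p) (hq : Function.Injective q) (hpq : ∀ i j, p i ≠ q j)
    (f : V → V) (hf : ∀ v, f (f v) = v) (hne : ∀ v, f v ≠ v) (v₁ : V)
    (hv : (∃ i, v₁ = p i) ∨ (∃ i, v₁ = q i))
    (hfv : ¬ ((∃ i, f v₁ = p i) ∨ (∃ i, f v₁ = q i)))
    (hc : ∀ v, ((∃ i, v = p i) ∨ (∃ i, v = q i)) → v ≠ v₁ →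
      ((∃ i, f v = p i) ∨ (∃ i, f v = q i))) : False := by
  set S : Finset V := Finset.univ.image p ∪ Finset.univ.image q with hS
  have hmem : ∀ v, v ∈ S ↔ ((∃ i, v = p i) ∨ (∃ i, v = q i)) := by
    intro v; simp [hS, eq_comm]
  have hcard : S.card = k + k := by
    rw [hS, Finset.card_union_of_disjoint, Finset.card_image_of_injective _ hp,
      Finset.card_image_of_injective _ hq]
    · simp
    · rw [Finset.disjoint_left]
      intro a ha hb
      simp only [Finset.mem_image, Finset.mem_univ, true_and] at ha hb
      obtain ⟨i, rfl⟩ := ha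
      obtain ⟨j, hj⟩ := hb
      exact hpq i j hj.symm
  have hsum : ∑ v ∈ S.erase v₁, (1 : ZMod 2) = 0 := by
    refine Finset.sum_involution (fun a _ => f a) ?_ ?_ ?_ ?_
    · intro a _; decide
    · intro a _ _; exact hne a
    · intro a ha
      rw [Finset.mem_erase] at ha ⊢
      refine ⟨?_, (hmem _).2 (hc a ((hmem a).1 ha.2) ha.1)⟩
      intro h
      apply hfv
      rw [← h, hf]
      exact (hmem a).1 ha.2
    · intro a _; exact hf a
  rw [Finset.sum_const, nsmul_one, ZMod.natCast_eq_zero_iff] at hsum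
  have := Finset.card_erase_add_one ((hmem v₁).2 hv)
  omega

theorem aux_nbr {k : ℕ} (v t : GkV k) (hv : InUW v) (h : GkRel k v t ∨ GkRel k t v) :
    t = .x1 ∨ t = .x2 ∨ InUW t := by
  rcases hv with ⟨i, rfl⟩ | ⟨i, rfl⟩ <;> cases t <;> simp [GkRel, InUW] at h ⊢

/-- Every perfect matching `M` of `G_k` satisfies the
one-sided property: (a) if `x₁x₂ ∈ M` then `M = M₀`; (b) `M` cannot contain
edges `x₁v₁`, `x₂v₂` with one of `v₁, v₂` in `U ∪ W` and the other in `Y ∪ Z`.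
Consequently, `M` equals `M₀`, or matches both `x₁` and `x₂` into `U ∪ W`, or
matches both `x₁` and `x₂` into `Y ∪ Z`. -/
theorem Gk_one_sided (k : ℕ) (hk : 1 ≤ k) (M : Set (Sym2 (GkV k)))
    (hM : IsPM (Gk k) M) :
    (s(GkV.x1, GkV.x2) ∈ M → M = GkM0 k) ∧
    (¬ ∃ v₁ v₂ : GkV k, s(GkV.x1, v₁) ∈ M ∧ s(GkV.x2, v₂) ∈ M ∧
        ((InUW v₁ ∧ InYZ v₂) ∨ (InYZ v₁ ∧ InUW v₂))) ∧
    (M = GkM0 k ∨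
      (∃ v₁ v₂ : GkV k, InUW v₁ ∧ InUW v₂ ∧
        s(GkV.x1, v₁) ∈ M ∧ s(GkV.x2, v₂) ∈ M) ∨
      (∃ v₁ v₂ : GkV k, InYZ v₁ ∧ InYZ v₂ ∧
        s(GkV.x1, v₁) ∈ M ∧ s(GkV.x2, v₂) ∈ M)) := by
  obtain ⟨f, hadj, hinv, hfM⟩ := aux_partner (Gk k) M hM
  have hne : ∀ v, f v ≠ v := fun v h => (hadj v).ne h.symm
  have hrel : ∀ v, GkRel k v (f v) ∨ GkRel k (f v) v := fun v =>
    ((SimpleGraph.fromRel_adj _ _ _).1 (hadj v)).2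
  have ha : f .x1 = .x2 → M = GkM0 k := by
    intro hx
    have hx' : f .x2 = .x1 := by rw [← hx, hinv]
    have hu : ∀ i, ∃ j, i ≤ j ∧ f (.u i) = .w j := by
      intro i
      have h := hrel (.u i)
      have h' := hinv (.u i)
      cases hv : f (.u i) <;> rw [hv] at h h' <;> simp_all [GkRel]
    have hz : ∀ i, ∃ j, i ≤ j ∧ f (.z i) = .y j := by
      intro i
      have h := hrel (.z i)
      have h' := hinv (.z i)
      cases hv : f (.z i) <;> rw [hv] at h h' <;> simp_all [GkRel]
    choose g hg1 hg2 using hu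
    choose g' hg1' hg2' using hz
    have e1 := aux_id g (fun a b hab => by
      have := hinv (.u a)
      rw [hg2, hab, ← hg2, hinv] at this
      exact (GkV.u.inj this).symm) hg1
    have e2 := aux_id g' (fun a b hab => by
      have := hinv (.z a)
      rw [hg2', hab, ← hg2', hinv] at this
      exact (GkV.z.inj this).symm) hg1'
    have fu : ∀ i, f (.u i) = .w i := fun i => by rw [hg2, e1]
    have fz : ∀ i, f (.z i) = .y i := fun i => by rw [hg2', e2]
    have fw : ∀ i, f (.w i) = .u i := fun i => by rw [← fu, hinv]
    have fy : ∀ i, f (.y i) = .z i := fun i => by rw [← fz, hinv]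
    ext e
    induction e using Sym2.ind with
    | _ a b =>
      rw [hfM]
      cases a <;> cases b <;> simp [GkM0, fu, fz, fw, fy, hx, hx', eq_comm]
  have key : ∀ a b : GkV k, ((a = .x1 ∧ b = .x2) ∨ (a = .x2 ∧ b = .x1)) →
      InUW (f a) → InYZ (f b) → False := by
    intro a b hab h1 h2
    refine aux_parity GkV.u GkV.w (fun _ _ => GkV.u.inj) (fun _ _ => GkV.w.inj)
      (by simp) f hinv hne (f a) h1 ?_ ?_
    · rw [hinv]
      rcases hab with ⟨rfl, rfl⟩ | ⟨rfl, rfl⟩ <;> simp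
    · intro v hv hva
      have h := hrel v
      have hb : f v ≠ b := by
        rintro rfl
        rw [hinv] at h2
        rcases hv with ⟨i, rfl⟩ | ⟨i, rfl⟩ <;> simp [InYZ] at h2
      have haa : f v ≠ a := by
        rintro rfl
        exact hva (hinv v).symm
      rcases aux_nbr v (f v) hv h with h | h | h
      · rcases hab with ⟨rfl, rfl⟩ | ⟨rfl, rfl⟩
        · exact (haa h).elim
        · exact (hb h).elim
      · rcases hab with ⟨rfl, rfl⟩ | ⟨rfl, rfl⟩
        · exact (hb h).elim
        · exact (haa h).elim
      · exact h
  refine ⟨fun h => ha ((hfM _ _).1 h), ?_, ?_⟩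
  · rintro ⟨v₁, v₂, h1, h2, h3⟩
    rw [hfM] at h1 h2
    subst h1 h2
    rcases h3 with ⟨h3, h4⟩ | ⟨h3, h4⟩
    · exact key .x1 .x2 (by simp) h3 h4
    · exact key .x2 .x1 (by simp) h4 h3
  · by_cases hx : f .x1 = .x2
    · exact Or.inl (ha hx)
    · have hx' : f .x2 ≠ .x1 := fun h => hx (by rw [← h, hinv])
      have c1 : InUW (f .x1) ∨ InYZ (f .x1) := by
        have := hne .x1
        cases hv : f .x1 <;> simp_all [InUW, InYZ]
      have c2 : InUW (f .x2) ∨ InYZ (f .x2) := by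
        have := hne .x2
        cases hv : f .x2 <;> simp_all [InUW, InYZ]
      right
      rcases c1 with c1 | c1 <;> rcases c2 with c2 | c2
      · exact Or.inl ⟨_, _, c1, c2, (hfM _ _).2 rfl, (hfM _ _).2 rfl⟩
      · exact (key .x1 .x2 (by simp) c1 c2).elim
      · exact (key .x2 .x1 (by simp) c2 c1).elim
      · exact Or.inr ⟨_, _, c1, c2, (hfM _ _).2 rfl, (hfM _ _).2 rfl⟩
end

section
/- For every k ≥ 1, the graph G_k has exactly 2·3^k − 1 perfect matchings. -/
namespace GkAux

/-- Codes: injections `Fin k → Fin (k+2)` with `i ≤ f i`. -/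
abbrev A (k : ℕ) := {f : Fin k → Fin (k + 2) // Function.Injective f ∧ ∀ i, i.val ≤ (f i).val}

lemma compl_two {k : ℕ} (f : Fin k → Fin (k + 2)) (hf : Function.Injective f) :
    ∃ a b, a ≠ b ∧ ∀ c, (∀ i, f i ≠ c) ↔ (c = a ∨ c = b) := by
  have h : ((Finset.univ.image f)ᶜ).card = 2 := by
    rw [Finset.card_compl, Finset.card_image_of_injective _ hf]
    simp
  obtain ⟨a, b, hab, h⟩ := Finset.card_eq_two.1 h
  refine ⟨a, b, hab, fun c => ?_⟩
  have := Finset.ext_iff.1 h c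
  simpa using this

/-- Removing the first index. -/
def tl {k : ℕ} (f : A (k + 1)) : A k :=
  ⟨fun i => ⟨(f.1 i.succ).val - 1, by have := (f.1 i.succ).isLt; omega⟩, by
    constructor
    · intro i j h
      have h1 := f.2.2 i.succ
      have h2 := f.2.2 j.succ
      simp only [Fin.mk.injEq, Fin.val_succ] at h h1 h2
      have : f.1 i.succ = f.1 j.succ := Fin.ext (by omega)
      exact Fin.succ_injective _ (f.2.1 this)
    · intro i
      have h1 := f.2.2 i.succ
      simp only [Fin.val_succ] at h1 ⊢
      omega⟩

lemma tl_succ {k : ℕ} (f : A (k + 1)) (i : Fin k) : ((tl f).1 i).succ = f.1 i.succ := by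
  have h1 := f.2.2 i.succ
  apply Fin.ext
  simp only [tl, Fin.val_succ] at h1 ⊢
  omega

def aEquiv (k : ℕ) : A (k + 1) ≃ Σ g : A k, {c : Fin (k + 3) // ∀ i, c ≠ (g.1 i).succ} where
  toFun f := ⟨tl f, ⟨f.1 0, fun i h => by
    rw [tl_succ] at h
    exact absurd (f.2.1 h) (Fin.succ_ne_zero i).symm⟩⟩
  invFun p := ⟨Fin.cons p.2.1 (fun i => (p.1.1 i).succ), by
    obtain ⟨g, c, hc⟩ := p
    constructor
    · intro i j
      refine Fin.cases ?_ (fun i => ?_) i <;> refine Fin.cases ?_ (fun j => ?_) j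
      · simp
      · intro h; exact absurd h (hc j)
      · intro h; exact absurd h.symm (hc i)
      · intro h
        have h : (g.1 i).succ = (g.1 j).succ := h
        rw [g.2.1 (Fin.succ_injective _ h)]
    · intro i
      refine Fin.cases ?_ (fun i => ?_) i
      · simp
      · have := g.2.2 i
        simpa using this⟩
  left_inv f := by
    apply Subtype.ext
    funext i
    refine Fin.cases ?_ (fun i => ?_) i
    · rfl
    · exact tl_succ f i
  right_inv p := by
    obtain ⟨g, c, hc⟩ := p
    rfl

lemma cardA (k : ℕ) : Fintype.card (A k) = 3 ^ k := by
  induction k with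
  | zero =>
    rw [pow_zero, Fintype.card_eq_one_iff]
    exact ⟨⟨fun i => i.elim0, fun i => i.elim0, fun i => i.elim0⟩,
      fun f => Subtype.ext (funext fun i => i.elim0)⟩
  | succ k ih =>
    rw [Fintype.card_congr (aEquiv k), Fintype.card_sigma]
    have : ∀ g : A k, Fintype.card {c : Fin (k + 3) // ∀ i, c ≠ (g.1 i).succ} = 3 := by
      intro g
      have h : (((Finset.univ.image fun i => (g.1 i).succ)ᶜ : Finset (Fin (k + 3)))).card = 3 := by
        rw [Finset.card_compl, Finset.card_image_of_injective (f := fun i => (g.1 i).succ) _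
          ((Fin.succ_injective _).comp g.2.1)]
        simp
      rw [Fintype.card_subtype]
      refine Eq.trans (congrArg Finset.card ?_) h
      ext c
      simp [eq_comm]
    simp [this, ih, pow_succ]

/-- The identity code. -/
def idA (k : ℕ) : A k :=
  ⟨fun i => ⟨i.val, by omega⟩, fun i j h => by simpa [Fin.ext_iff] using h, fun i => le_rfl⟩

lemma eq_idA {k : ℕ} (f : A k) (h : ∀ i, (f.1 i).val < k) : f = idA k := by
  apply Subtype.ext
  have key : ∀ n, ∀ i : Fin k, k - i.val ≤ n → (f.1 i).val = i.val := by
    intro n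
    induction n with
    | zero => intro i hi; omega
    | succ n ih =>
      intro i hi
      by_contra hne
      have h1 := f.2.2 i
      have h2 := ih ⟨(f.1 i).val, h i⟩ (by simp only; omega)
      have h3 := f.2.1 (Fin.ext h2)
      exact hne (congrArg Fin.val h3)
  funext i
  exact Fin.ext (key _ i le_rfl)

abbrev Code (k : ℕ) := {p : A k × A k // p.1 = idA k ∨ p.2 = idA k}

lemma cardCode (k : ℕ) : Nat.card (Code k) = 2 * 3 ^ k - 1 := by
  classical
  rw [Nat.card_eq_fintype_card, Fintype.card_subtype]
  have e : (Finset.univ.filter fun p : A k × A k => p.1 = idA k ∨ p.2 = idA k) =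
      ({idA k} ×ˢ Finset.univ) ∪ (Finset.univ ×ˢ {idA k}) := by
    ext ⟨a, b⟩; simp [eq_comm (a := idA k)]
  have e2 : (({idA k} : Finset (A k)) ×ˢ (Finset.univ : Finset (A k))) ∩
      (Finset.univ ×ˢ {idA k}) = {(idA k, idA k)} := by
    ext ⟨a, b⟩; simp [eq_comm (a := idA k)]
  rw [e, Finset.card_union, e2, Finset.card_product, Finset.card_product, Finset.card_univ, cardA]
  simp
  omega

/-- `W ∪ X` indexed by `Fin (k+2)`. -/
def ph {k : ℕ} (j : Fin (k + 2)) : GkV k :=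
  if h : j.val < k then .w ⟨j.val, h⟩ else if j.val = k then .x1 else .x2

/-- `Y ∪ X` indexed by `Fin (k+2)`. -/
def ps {k : ℕ} (j : Fin (k + 2)) : GkV k :=
  if h : j.val < k then .y ⟨j.val, h⟩ else if j.val = k then .x1 else .x2

lemma ph_inj {k : ℕ} : Function.Injective (ph (k := k)) := by
  intro a b h
  apply Fin.ext
  unfold ph at h
  split_ifs at h <;> simp at h <;> omega

lemma ps_inj {k : ℕ} : Function.Injective (ps (k := k)) := by
  intro a b h
  apply Fin.ext
  unfold ps at h
  split_ifs at h <;> simp at h <;> omega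

lemma ph_ne_u {k : ℕ} (j : Fin (k + 2)) (i) : ph j ≠ GkV.u i := by
  unfold ph; split_ifs <;> simp
lemma ph_ne_z {k : ℕ} (j : Fin (k + 2)) (i) : ph j ≠ GkV.z i := by
  unfold ph; split_ifs <;> simp
lemma ps_ne_u {k : ℕ} (j : Fin (k + 2)) (i) : ps j ≠ GkV.u i := by
  unfold ps; split_ifs <;> simp
lemma ps_ne_z {k : ℕ} (j : Fin (k + 2)) (i) : ps j ≠ GkV.z i := by
  unfold ps; split_ifs <;> simp
lemma ph_ne_y {k : ℕ} (j : Fin (k + 2)) (i) : ph j ≠ GkV.y i := by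
  unfold ph; split_ifs <;> simp
lemma ps_ne_w {k : ℕ} (j : Fin (k + 2)) (i) : ps j ≠ GkV.w i := by
  unfold ps; split_ifs <;> simp

lemma ph_w {k : ℕ} (i : Fin k) : ph (⟨i.val, by omega⟩ : Fin (k + 2)) = GkV.w i := by simp [ph]
lemma ps_y {k : ℕ} (i : Fin k) : ps (⟨i.val, by omega⟩ : Fin (k + 2)) = GkV.y i := by simp [ps]
lemma ph_x1 {k : ℕ} : ph (⟨k, by omega⟩ : Fin (k + 2)) = GkV.x1 := by simp [ph]
lemma ph_x2 {k : ℕ} : ph (⟨k + 1, by omega⟩ : Fin (k + 2)) = GkV.x2 := by simp [ph]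
lemma ps_x1 {k : ℕ} : ps (⟨k, by omega⟩ : Fin (k + 2)) = GkV.x1 := by simp [ps]
lemma ps_x2 {k : ℕ} : ps (⟨k + 1, by omega⟩ : Fin (k + 2)) = GkV.x2 := by simp [ps]

lemma ph_eq_ps {k : ℕ} (j : Fin (k + 2)) (h : k ≤ j.val) : ph j = ps j := by
  simp [ph, ps, not_lt.2 h]

lemma adj_ph {k : ℕ} {a b : Fin (k + 2)} (h : a ≠ b) : (Gk k).Adj (ph a) (ph b) := by
  refine (SimpleGraph.fromRel_adj _ _ _).2 ⟨fun e => h (ph_inj e), ?_⟩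
  have h : a.val ≠ b.val := fun e => h (Fin.ext e)
  unfold ph
  split_ifs <;> simp [GkRel] <;> omega

lemma adj_ps {k : ℕ} {a b : Fin (k + 2)} (h : a ≠ b) : (Gk k).Adj (ps a) (ps b) := by
  refine (SimpleGraph.fromRel_adj _ _ _).2 ⟨fun e => h (ps_inj e), ?_⟩
  have h : a.val ≠ b.val := fun e => h (Fin.ext e)
  unfold ps
  split_ifs <;> simp [GkRel] <;> omega

lemma adj_u {k : ℕ} (i : Fin k) (v : GkV k) :
    (Gk k).Adj (.u i) v ↔ ∃ j : Fin (k + 2), i.val ≤ j.val ∧ v = ph j := by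
  constructor
  · intro h
    have h := ((SimpleGraph.fromRel_adj _ _ _).1 h).2
    cases v with
    | u j => simp [GkRel] at h
    | w j => exact ⟨_, by simpa [GkRel] using h, (ph_w j).symm⟩
    | x1 => exact ⟨_, by dsimp only; omega, ph_x1.symm⟩
    | x2 => exact ⟨_, by dsimp only; omega, ph_x2.symm⟩
    | y j => simp [GkRel] at h
    | z j => simp [GkRel] at h
  · rintro ⟨j, hj, rfl⟩
    refine (SimpleGraph.fromRel_adj _ _ _).2 ⟨(ph_ne_u j i).symm, ?_⟩
    unfold ph
    split_ifs <;> simp [GkRel, Fin.le_def, hj]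

lemma adj_z {k : ℕ} (i : Fin k) (v : GkV k) :
    (Gk k).Adj (.z i) v ↔ ∃ j : Fin (k + 2), i.val ≤ j.val ∧ v = ps j := by
  constructor
  · intro h
    have h := ((SimpleGraph.fromRel_adj _ _ _).1 h).2
    cases v with
    | u j => simp [GkRel] at h
    | y j => exact ⟨_, by simpa [GkRel] using h, (ps_y j).symm⟩
    | x1 => exact ⟨_, by dsimp only; omega, ps_x1.symm⟩
    | x2 => exact ⟨_, by dsimp only; omega, ps_x2.symm⟩
    | w j => simp [GkRel] at h
    | z j => simp [GkRel] at h
  · rintro ⟨j, hj, rfl⟩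
    refine (SimpleGraph.fromRel_adj _ _ _).2 ⟨(ps_ne_z j i).symm, ?_⟩
    unfold ps
    split_ifs <;> simp [GkRel, Fin.le_def, hj]

/-- Vertices not covered by the code edges. -/
def Free {k : ℕ} (f g : A k) (a : GkV k) : Prop :=
  (∀ i, a ≠ .u i) ∧ (∀ i, a ≠ .z i) ∧ (∀ i, a ≠ ph (f.1 i)) ∧ ∀ i, a ≠ ps (g.1 i)

def mat {k : ℕ} (f g : A k) : Set (Sym2 (GkV k)) :=
  {e | (∃ i, e = s(.u i, ph (f.1 i))) ∨ (∃ i, e = s(.z i, ps (g.1 i))) ∨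
    ∃ a b, a ≠ b ∧ Free f g a ∧ Free f g b ∧ e = s(a, b)}

lemma mat_pm {k : ℕ} (f g : A k) (hd : ∀ i j, ph (f.1 i) ≠ ps (g.1 j)) (p q : GkV k)
    (hpq : (Gk k).Adj p q) (hF : ∀ a, Free f g a ↔ a = p ∨ a = q) : IsPM (Gk k) (mat f g) := by
  have hp := (hF p).2 (Or.inl rfl)
  have hq := (hF q).2 (Or.inr rfl)
  have hm : ∀ e, e ∈ mat f g ↔ (∃ i, e = s(.u i, ph (f.1 i))) ∨ (∃ i, e = s(.z i, ps (g.1 i))) ∨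
      e = s(p, q) := by
    intro e
    refine or_congr Iff.rfl (or_congr Iff.rfl ?_)
    constructor
    · rintro ⟨a, b, hab, ha, hb, rfl⟩
      rcases (hF a).1 ha with rfl | rfl <;> rcases (hF b).1 hb with rfl | rfl
      · exact absurd rfl hab
      · rfl
      · exact Sym2.eq_swap
      · exact absurd rfl hab
    · rintro rfl
      exact ⟨p, q, hpq.ne, hp, hq, rfl⟩
  refine ⟨?_, ?_, ?_⟩
  · intro e he
    rcases (hm e).1 he with ⟨i, rfl⟩ | ⟨i, rfl⟩ | rfl
    · exact (adj_u i _).2 ⟨_, f.2.2 i, rfl⟩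
    · exact (adj_z i _).2 ⟨_, g.2.2 i, rfl⟩
    · exact hpq
  · intro e he e' he' hne v ⟨hv, hv'⟩
    apply hne
    have hfi := f.2.1
    have hgi := g.2.1
    obtain ⟨p1, p2, p3, p4⟩ := hp
    obtain ⟨q1, q2, q3, q4⟩ := hq
    rcases (hm e).1 he with ⟨i, rfl⟩ | ⟨i, rfl⟩ | rfl <;>
    rcases (hm e').1 he' with ⟨j, rfl⟩ | ⟨j, rfl⟩ | rfl <;>
    rw [Sym2.mem_iff] at hv hv' <;> rcases hv with rfl | rfl <;> rcases hv' with hv' | hv' <;>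
    first
      | rfl
      | (injection hv' with hv'; rw [hv'])
      | (rw [hfi (ph_inj hv')])
      | (rw [hgi (ps_inj hv')])
      | exact absurd hv' (ph_ne_u _ _)
      | exact absurd hv' (ph_ne_z _ _)
      | exact absurd hv' (ps_ne_u _ _)
      | exact absurd hv' (ps_ne_z _ _)
      | exact absurd hv'.symm (ph_ne_u _ _)
      | exact absurd hv'.symm (ph_ne_z _ _)
      | exact absurd hv'.symm (ps_ne_u _ _)
      | exact absurd hv'.symm (ps_ne_z _ _)
      | exact absurd hv' (hd _ _)
      | exact absurd hv'.symm (hd _ _)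
      | exact absurd hv' (p1 _)
      | exact absurd hv' (p2 _)
      | exact absurd hv' (p3 _)
      | exact absurd hv' (p4 _)
      | exact absurd hv' (q1 _)
      | exact absurd hv' (q2 _)
      | exact absurd hv' (q3 _)
      | exact absurd hv' (q4 _)
      | exact absurd hv'.symm (p1 _)
      | exact absurd hv'.symm (p2 _)
      | exact absurd hv'.symm (p3 _)
      | exact absurd hv'.symm (p4 _)
      | exact absurd hv'.symm (q1 _)
      | exact absurd hv'.symm (q2 _)
      | exact absurd hv'.symm (q3 _)
      | exact absurd hv'.symm (q4 _)
      | cases hv'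
  · intro v
    by_cases h : Free f g v
    · refine ⟨s(p, q), (hm _).2 (Or.inr (Or.inr rfl)), ?_⟩
      exact Sym2.mem_iff.2 ((hF v).1 h)
    · by_contra hcon
      apply h
      refine ⟨?_, ?_, ?_, ?_⟩ <;> rintro i rfl <;> apply hcon
      · exact ⟨_, Or.inl ⟨i, rfl⟩, Sym2.mem_mk_left _ _⟩
      · exact ⟨_, Or.inr (Or.inl ⟨i, rfl⟩), Sym2.mem_mk_left _ _⟩
      · exact ⟨_, Or.inl ⟨i, rfl⟩, Sym2.mem_mk_right _ _⟩
      · exact ⟨_, Or.inr (Or.inl ⟨i, rfl⟩), Sym2.mem_mk_right _ _⟩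

lemma ph_id {k : ℕ} (i : Fin k) : ph ((idA k).1 i) = GkV.w i := ph_w i
lemma ps_id {k : ℕ} (i : Fin k) : ps ((idA k).1 i) = GkV.y i := ps_y i

lemma mat_pm_code {k : ℕ} (c : Code k) : IsPM (Gk k) (mat c.1.1 c.1.2) := by
  obtain ⟨⟨f, g⟩, h | h⟩ := c <;> simp only at h <;> subst h
  · obtain ⟨a, b, hab, h⟩ := compl_two g.1 g.2.1
    refine mat_pm _ _ ?_ (ps a) (ps b) (adj_ps hab) ?_
    · intro i j; rw [ph_id]; exact (ps_ne_w _ _).symm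
    · have key : ∀ c, Free (idA k) g (ps c) ↔ ps c = ps a ∨ ps c = ps b := by
        intro c
        rw [ps_inj.eq_iff, ps_inj.eq_iff, ← h c]
        constructor
        · rintro ⟨-, -, -, h4⟩ i hi
          exact h4 i (by rw [hi])
        · intro hc
          exact ⟨ps_ne_u c, ps_ne_z c, fun i => by rw [ph_id]; exact ps_ne_w c i,
            fun i hi => hc i (ps_inj hi).symm⟩
      intro v
      cases v with
      | u i => simp [Free, (ps_ne_u _ _).symm]
      | z i => simp [Free, (ps_ne_z _ _).symm]
      | w i => simp [Free, ph_id, (ps_ne_w _ _).symm]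
      | y i => rw [← ps_y]; exact key _
      | x1 => rw [← ps_x1]; exact key _
      | x2 => rw [← ps_x2]; exact key _
  · obtain ⟨a, b, hab, h⟩ := compl_two f.1 f.2.1
    refine mat_pm _ _ ?_ (ph a) (ph b) (adj_ph hab) ?_
    · intro i j; rw [ps_id]; exact ph_ne_y _ _
    · have key : ∀ c, Free f (idA k) (ph c) ↔ ph c = ph a ∨ ph c = ph b := by
        intro c
        rw [ph_inj.eq_iff, ph_inj.eq_iff, ← h c]
        constructor
        · rintro ⟨-, -, h4, -⟩ i hi
          exact h4 i (by rw [hi])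
        · intro hc
          exact ⟨ph_ne_u c, ph_ne_z c, fun i hi => hc i (ph_inj hi).symm,
            fun i => by rw [ps_id]; exact ph_ne_y c i⟩
      intro v
      cases v with
      | u i => simp [Free, (ph_ne_u _ _).symm]
      | z i => simp [Free, (ph_ne_z _ _).symm]
      | y i => simp [Free, ps_id, (ph_ne_y _ _).symm]
      | w i => rw [← ph_w]; exact key _
      | x1 => rw [← ph_x1]; exact key _
      | x2 => rw [← ph_x2]; exact key _

lemma pm_uniq {V : Type*} {G : SimpleGraph V} {M : Set (Sym2 V)} (h : IsPM G M) {e e' : Sym2 V}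
    (he : e ∈ M) (he' : e' ∈ M) {v : V} (hv : v ∈ e) (hv' : v ∈ e') : e = e' := by
  by_contra hne
  exact h.2.1 e he e' he' hne v ⟨hv, hv'⟩

lemma pm_partner {V : Type*} {G : SimpleGraph V} {M : Set (Sym2 V)} (h : IsPM G M) (v : V) :
    ∃ w, G.Adj v w ∧ s(v, w) ∈ M := by
  obtain ⟨e, he, hv⟩ := h.2.2 v
  obtain ⟨w, rfl⟩ := hv
  exact ⟨w, h.1 he, he⟩

lemma pm_eq_of_subset {V : Type*} {G : SimpleGraph V} {M N : Set (Sym2 V)} (h : IsPM G M)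
    (h' : IsPM G N) (hs : M ⊆ N) : M = N := by
  refine hs.antisymm fun e he => ?_
  induction e with
  | _ a b =>
    obtain ⟨w, -, hw⟩ := pm_partner h a
    rw [pm_uniq h' he (hs hw) (Sym2.mem_mk_left a b) (Sym2.mem_mk_left a w)]
    exact hw

lemma pm_codes {k : ℕ} {M : Set (Sym2 (GkV k))} (h : IsPM (Gk k) M) :
    ∃ f g : A k, (∀ i, s(.u i, ph (f.1 i)) ∈ M) ∧ (∀ i, s(.z i, ps (g.1 i)) ∈ M) := by
  have hu : ∀ i : Fin k, ∃ j : Fin (k + 2), i.val ≤ j.val ∧ s(.u i, ph j) ∈ M := by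
    intro i
    obtain ⟨w, hw, hm⟩ := pm_partner h (.u i)
    obtain ⟨j, hj, rfl⟩ := (adj_u i w).1 hw
    exact ⟨j, hj, hm⟩
  have hz : ∀ i : Fin k, ∃ j : Fin (k + 2), i.val ≤ j.val ∧ s(.z i, ps j) ∈ M := by
    intro i
    obtain ⟨w, hw, hm⟩ := pm_partner h (.z i)
    obtain ⟨j, hj, rfl⟩ := (adj_z i w).1 hw
    exact ⟨j, hj, hm⟩
  choose f hf hfM using hu
  choose g hg hgM using hz
  refine ⟨⟨f, fun i j hij => ?_, hf⟩, ⟨g, fun i j hij => ?_, hg⟩, hfM, hgM⟩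
  · have := pm_uniq h (hfM i) (hfM j) (Sym2.mem_mk_right _ _) (hij ▸ Sym2.mem_mk_right _ _)
    rw [hij, Sym2.congr_left] at this
    injection this
  · have := pm_uniq h (hgM i) (hgM j) (Sym2.mem_mk_right _ _) (hij ▸ Sym2.mem_mk_right _ _)
    rw [hij, Sym2.congr_left] at this
    injection this

lemma pm_id {k : ℕ} {M : Set (Sym2 (GkV k))} (h : IsPM (Gk k) M) (f g : A k)
    (hf : ∀ i, s(.u i, ph (f.1 i)) ∈ M) (hg : ∀ i, s(.z i, ps (g.1 i)) ∈ M) :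
    f = idA k ∨ g = idA k := by
  by_contra hcon
  push Not at hcon
  obtain ⟨h1, h2⟩ := hcon
  have hi : ∃ i, k ≤ (f.1 i).val := by
    by_contra hc; push Not at hc; exact h1 (eq_idA f hc)
  have hj : ∃ j, k ≤ (g.1 j).val := by
    by_contra hc; push Not at hc; exact h2 (eq_idA g hc)
  obtain ⟨i, hi⟩ := hi
  obtain ⟨j, hj⟩ := hj
  have hd : ∀ i', f.1 i' ≠ g.1 j := by
    intro i' e
    have h3 := hf i'
    rw [e, ph_eq_ps _ hj] at h3
    have := pm_uniq h h3 (hg j) (Sym2.mem_mk_right _ _) (Sym2.mem_mk_right _ _)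
    rw [Sym2.congr_left] at this
    injection this
  obtain ⟨c, hc, hcu⟩ : ∃ c, (c ≠ g.1 j ∧ ∀ i', f.1 i' ≠ c) ∧
      ∀ d, (∀ i', f.1 i' ≠ d) → d = g.1 j ∨ d = c := by
    obtain ⟨a, b, hab, hh⟩ := compl_two f.1 f.2.1
    rcases (hh _).1 hd with e | e
    · exact ⟨b, ⟨e ▸ hab.symm, (hh b).2 (Or.inr rfl)⟩, fun d hd' => e ▸ (hh d).1 hd'⟩
    · exact ⟨a, ⟨e ▸ hab, (hh a).2 (Or.inl rfl)⟩, fun d hd' => e ▸ ((hh d).1 hd').symm⟩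
  have hck : c.val < k := by
    have e1 : (f.1 i).val ≠ (g.1 j).val := fun e => hd i (Fin.ext e)
    have e2 : c.val ≠ (g.1 j).val := fun e => hc.1 (Fin.ext e)
    have e3 : (f.1 i).val ≠ c.val := fun e => hc.2 i (Fin.ext e)
    have := (f.1 i).isLt
    have := (g.1 j).isLt
    have := c.isLt
    omega
  obtain ⟨v, hv, hvM⟩ := pm_partner h (ph c)
  -- the partner of `ph c` is some `ph d`
  have hfc : ∀ i', v ≠ GkV.u i' := by
    rintro i' rfl
    have := pm_uniq h hvM (hf i') (Sym2.mem_mk_right _ _) (Sym2.mem_mk_left _ _)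
    rw [Sym2.eq_swap, Sym2.congr_right] at this
    exact hc.2 i' (ph_inj this).symm
  have hvd : ∃ d, v = ph d := by
    cases v with
    | u i' => exact absurd rfl (hfc i')
    | w i' => exact ⟨_, (ph_w i').symm⟩
    | x1 => exact ⟨_, ph_x1.symm⟩
    | x2 => exact ⟨_, ph_x2.symm⟩
    | y i' =>
      have := ((SimpleGraph.fromRel_adj _ _ _).1 hv).2
      simp [ph, hck, GkRel] at this
    | z i' =>
      have := ((SimpleGraph.fromRel_adj _ _ _).1 hv).2
      simp [ph, hck, GkRel] at this
  obtain ⟨d, rfl⟩ := hvd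
  have hdf : ∀ i', f.1 i' ≠ d := by
    intro i' e
    have := pm_uniq h hvM (hf i') (Sym2.mem_mk_right _ _) (e ▸ Sym2.mem_mk_right _ _)
    rw [e, Sym2.congr_left] at this
    exact ph_ne_u _ _ this
  rcases hcu d hdf with e | e
  · have h3 := hg j
    rw [← ph_eq_ps _ hj, ← e] at h3
    have := pm_uniq h hvM h3 (Sym2.mem_mk_right _ _) (Sym2.mem_mk_right _ _)
    rw [Sym2.congr_left] at this
    exact ph_ne_z _ _ this
  · rw [e] at hv
    exact hv.ne rfl

lemma pm_sub {k : ℕ} {M : Set (Sym2 (GkV k))} (h : IsPM (Gk k) M) (f g : A k)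
    (hf : ∀ i, s(.u i, ph (f.1 i)) ∈ M) (hg : ∀ i, s(.z i, ps (g.1 i)) ∈ M) :
    M ⊆ mat f g := by
  intro e he
  by_cases hF : ∀ v ∈ e, Free f g v
  · induction e with
    | _ a b =>
      exact Or.inr (Or.inr ⟨a, b, (show (Gk k).Adj a b from h.1 he).ne,
        hF a (Sym2.mem_mk_left _ _), hF b (Sym2.mem_mk_right _ _), rfl⟩)
  · by_contra hcon
    apply hF
    intro v hv
    refine ⟨?_, ?_, ?_, ?_⟩ <;> rintro i rfl <;> apply hcon
    · exact Or.inl ⟨i, pm_uniq h he (hf i) hv (Sym2.mem_mk_left _ _)⟩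
    · exact Or.inr (Or.inl ⟨i, pm_uniq h he (hg i) hv (Sym2.mem_mk_left _ _)⟩)
    · exact Or.inl ⟨i, pm_uniq h he (hf i) hv (Sym2.mem_mk_right _ _)⟩
    · exact Or.inr (Or.inl ⟨i, pm_uniq h he (hg i) hv (Sym2.mem_mk_right _ _)⟩)

lemma mat_inj {k : ℕ} {f g f' g' : A k} (h : IsPM (Gk k) (mat f g)) (e : mat f g = mat f' g') :
    f = f' ∧ g = g' := by
  constructor
  · apply Subtype.ext; funext i
    have h1 : s(.u i, ph (f.1 i)) ∈ mat f g := Or.inl ⟨i, rfl⟩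
    have h2 : s(.u i, ph (f'.1 i)) ∈ mat f g := e ▸ Or.inl ⟨i, rfl⟩
    have := pm_uniq h h1 h2 (Sym2.mem_mk_left _ _) (Sym2.mem_mk_left _ _)
    rw [Sym2.congr_right] at this
    exact ph_inj this
  · apply Subtype.ext; funext i
    have h1 : s(.z i, ps (g.1 i)) ∈ mat f g := Or.inr (Or.inl ⟨i, rfl⟩)
    have h2 : s(.z i, ps (g'.1 i)) ∈ mat f g := e ▸ Or.inr (Or.inl ⟨i, rfl⟩)
    have := pm_uniq h h1 h2 (Sym2.mem_mk_left _ _) (Sym2.mem_mk_left _ _)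
    rw [Sym2.congr_right] at this
    exact ps_inj this

end GkAux

/-- For every `k ≥ 1`, the graph `G_k` has exactly
`2 * 3 ^ k - 1` perfect matchings. -/
theorem Gk_card_perfectMatchings (k : ℕ) (hk : 1 ≤ k) :
    Nat.card {M : Set (Sym2 (GkV k)) // IsPM (Gk k) M} = 2 * 3 ^ k - 1 := by
  rw [← GkAux.cardCode k]
  symm
  refine Nat.card_congr (Equiv.ofBijective
    (fun c : GkAux.Code k => ⟨GkAux.mat c.1.1 c.1.2, GkAux.mat_pm_code c⟩) ⟨?_, ?_⟩)
  · intro c c' h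
    have h := GkAux.mat_inj (GkAux.mat_pm_code c) (congrArg Subtype.val h)
    exact Subtype.ext (Prod.ext h.1 h.2)
  · rintro ⟨M, hM⟩
    obtain ⟨f, g, hf, hg⟩ := GkAux.pm_codes hM
    let c : GkAux.Code k := ⟨(f, g), GkAux.pm_id hM f g hf hg⟩
    exact ⟨c, Subtype.ext (GkAux.pm_eq_of_subset hM (GkAux.mat_pm_code c)
      (GkAux.pm_sub hM f g hf hg)).symm⟩
end

section
/- For every k ≥ 1, every perfect matching M of the graph G_k is at distance at most k from M₀ in the transition graph 𝒢(G_k); in particular, 𝒢(G_k) is connected. -/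
theorem pm_unique {V : Type*} {G : SimpleGraph V} {M : Set (Sym2 V)} (h : IsPM G M)
    {a b c : V} (hb : s(a, b) ∈ M) (hc : s(a, c) ∈ M) : b = c := by
  by_contra hne
  exact h.2.1 _ hb _ hc (fun he => hne (Sym2.congr_right.1 he)) a ⟨by simp, by simp⟩

theorem pm_adj {V : Type*} {G : SimpleGraph V} {M : Set (Sym2 V)} (h : IsPM G M)
    {a b : V} (hb : s(a, b) ∈ M) : G.Adj a b := h.1 hb

theorem pm_partner {V : Type*} {G : SimpleGraph V} {M : Set (Sym2 V)} (h : IsPM G M)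
    (a : V) : ∃ b, s(a, b) ∈ M := by
  obtain ⟨e, he, hae⟩ := h.2.2 a
  obtain ⟨b, rfl⟩ := hae
  exact ⟨b, he⟩

theorem pm_of {V : Type*} {G : SimpleGraph V} {M : Set (Sym2 V)}
    (h1 : ∀ a b, s(a, b) ∈ M → G.Adj a b)
    (h2 : ∀ a b c, s(a, b) ∈ M → s(a, c) ∈ M → b = c)
    (h3 : ∀ a, ∃ b, s(a, b) ∈ M) : IsPM G M := by
  refine ⟨?_, ?_, ?_⟩
  · intro e
    induction e with | _ a b => exact h1 a b
  · rintro e he f hf hne v ⟨⟨b, rfl⟩, ⟨c, rfl⟩⟩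
    exact hne (by rw [h2 _ _ _ he hf])
  · intro v
    obtain ⟨b, hb⟩ := h3 v
    exact ⟨_, hb, by simp⟩

theorem pm_eq {V : Type*} {G : SimpleGraph V} {M N : Set (Sym2 V)} (h : IsPM G M)
    (h' : IsPM G N) (hs : M ⊆ N) : M = N := by
  apply Set.Subset.antisymm hs
  intro e
  induction e with | _ a b =>
  intro he
  obtain ⟨c, hc⟩ := pm_partner h a
  rwa [pm_unique h' he (hs hc)]

/-- A switch creating the edge `ab` from `ac`, `bd`. -/
theorem switch_step_s13 {V : Type*} {G : SimpleGraph V} {M N : Set (Sym2 V)} (h : IsPM G M)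
    (hN : IsPM G N) {a b c d : V} (hab : s(a, b) ∈ N) (hab' : s(a, b) ∉ M)
    (hac : s(a, c) ∈ M) (hbd : s(b, d) ∈ M) (hcd : G.Adj c d) :
    ∃ (M' : Set (Sym2 V)) (h' : IsPM G M'), (TransGraph G).Adj ⟨M, h⟩ ⟨M', h'⟩ ∧
      s(a, b) ∈ M' ∧ N \ M' ⊆ N \ M := by
  have Aab := pm_adj hN hab
  have Aac := pm_adj h hac
  have Abd := pm_adj h hbd
  have nab := Aab.ne
  have nac := Aac.ne
  have nbd := Abd.ne
  have ncd := hcd.ne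
  have nbc : b ≠ c := by rintro rfl; exact hab' hac
  have nad : a ≠ d := by rintro rfl; exact hab' (by rwa [Sym2.eq_swap])
  have hmem : ∀ x y, s(x, y) ∈ (M \ {s(a, c), s(d, b)}) ∪ {s(d, c), s(a, b)} ↔
      (s(x, y) ∈ M ∧ x ≠ a ∧ x ≠ b ∧ x ≠ c ∧ x ≠ d) ∨
      (x = a ∧ y = b) ∨ (x = b ∧ y = a) ∨ (x = c ∧ y = d) ∨ (x = d ∧ y = c) := by
    intro x y
    have hca : s(c, a) ∈ M := by rwa [Sym2.eq_swap]
    have hdb : s(d, b) ∈ M := by rwa [Sym2.eq_swap]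
    simp only [Set.mem_union, Set.mem_sdiff, Set.mem_insert_iff, Set.mem_singleton_iff,
      Sym2.eq_iff]
    constructor
    · rintro (⟨hxy, hn⟩ | hh)
      · left
        refine ⟨hxy, ?_, ?_, ?_, ?_⟩ <;> rintro rfl
        · exact hn (Or.inl (Or.inl ⟨rfl, pm_unique h hxy hac⟩))
        · exact hn (Or.inr (Or.inr ⟨rfl, pm_unique h hxy hbd⟩))
        · exact hn (Or.inl (Or.inr ⟨rfl, pm_unique h hxy hca⟩))
        · exact hn (Or.inr (Or.inl ⟨rfl, pm_unique h hxy hdb⟩))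
      · right; tauto
    · rintro (⟨hxy, hn⟩ | hh)
      · left; exact ⟨hxy, by tauto⟩
      · right; tauto
  have hPM : IsPM G ((M \ {s(a, c), s(d, b)}) ∪ {s(d, c), s(a, b)}) := by
    refine pm_of ?_ ?_ ?_
    · intro x y hxy
      rw [hmem] at hxy
      rcases hxy with ⟨hxy, -⟩ | ⟨rfl, rfl⟩ | ⟨rfl, rfl⟩ | ⟨rfl, rfl⟩ | ⟨rfl, rfl⟩
      · exact pm_adj h hxy
      · exact Aab
      · exact Aab.symm
      · exact hcd
      · exact hcd.symm
    · intro x y z hy hz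
      rw [hmem] at hy hz
      rcases hy with ⟨hxy, hy⟩ | hy
      · rcases hz with ⟨hxz, hz⟩ | hz
        · exact pm_unique h hxy hxz
        · grind
      · grind
    · intro x
      obtain ⟨y, hy⟩ := pm_partner h x
      simp only [hmem]
      by_cases h1 : x = a
      · exact ⟨b, by tauto⟩
      by_cases h2 : x = b
      · exact ⟨a, by tauto⟩
      by_cases h3 : x = c
      · exact ⟨d, by tauto⟩
      by_cases h4 : x = d
      · exact ⟨c, by tauto⟩
      exact ⟨y, by tauto⟩
  refine ⟨_, hPM, ?_, ?_, ?_⟩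
  · rw [TransGraph, SimpleGraph.fromRel_adj]
    refine ⟨?_, Or.inl ⟨a, c, d, b, nac, nad, nab, ncd, nbc.symm, nbd.symm, hac, ?_, ?_, Aab, rfl⟩⟩
    · intro he
      apply hab'
      have := congrArg Subtype.val he
      simp only at this
      rw [this]
      simp
    · rwa [Sym2.eq_swap]
    · exact hcd.symm
  · simp
  · rintro e ⟨he, he'⟩
    refine ⟨he, fun heM => he' (Or.inl ⟨heM, ?_⟩)⟩
    rintro (rfl | rfl)
    · exact nbc (pm_unique hN hab he)
    · rw [Sym2.eq_swap] at he hab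
      exact nad (pm_unique hN hab he)

/-- One side of the graph. -/
structure GkSide (k : ℕ) (u w : Fin k → GkV k) : Prop where
  winj : Function.Injective w
  uinj : Function.Injective u
  wx1 : ∀ i, w i ≠ .x1
  wx2 : ∀ i, w i ≠ .x2
  uw : ∀ i j, u i ≠ w j
  ux1 : ∀ i, u i ≠ .x1
  ux2 : ∀ i, u i ≠ .x2
  uadj : ∀ i v, (Gk k).Adj (u i) v → (∃ j, i ≤ j ∧ v = w j) ∨ v = .x1 ∨ v = .x2
  wadj : ∀ i v, (Gk k).Adj (w i) v → (∃ j, v = u j) ∨ (∃ j, v = w j) ∨ v = .x1 ∨ v = .x2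
  clique : ∀ a b, ((∃ j, a = w j) ∨ a = .x1 ∨ a = .x2) →
    ((∃ j, b = w j) ∨ b = .x1 ∨ b = .x2) → a ≠ b → (Gk k).Adj a b
  mem0 : ∀ i, s(u i, w i) ∈ GkM0 k

theorem side_uw (k : ℕ) : GkSide k .u .w where
  winj := by intro i j h; simpa using h
  uinj := by intro i j h; simpa using h
  wx1 := by simp
  wx2 := by simp
  uw := by simp
  ux1 := by simp
  ux2 := by simp
  uadj := by intro i v; cases v <;> simp [Gk, GkRel]
  wadj := by intro i v; cases v <;> simp [Gk, GkRel]
  clique := by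
    rintro a b (⟨i, rfl⟩ | rfl | rfl) (⟨j, rfl⟩ | rfl | rfl) <;> simp +contextual [Gk, GkRel]
  mem0 := by simp [GkM0]

theorem side_zy (k : ℕ) : GkSide k .z .y where
  winj := by intro i j h; simpa using h
  uinj := by intro i j h; simpa using h
  wx1 := by simp
  wx2 := by simp
  uw := by simp
  ux1 := by simp
  ux2 := by simp
  uadj := by intro i v; cases v <;> simp [Gk, GkRel]
  wadj := by intro i v; cases v <;> simp [Gk, GkRel]
  clique := by
    rintro a b (⟨i, rfl⟩ | rfl | rfl) (⟨j, rfl⟩ | rfl | rfl) <;> simp +contextual [Gk, GkRel]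
  mem0 := by intro i; rw [Sym2.eq_swap]; simp [GkM0]

/-- The partner of a vertex in `M₀`. -/
def m0p {k : ℕ} : GkV k → GkV k
  | .u i => .w i
  | .w i => .u i
  | .y i => .z i
  | .z i => .y i
  | .x1 => .x2
  | .x2 => .x1

theorem mem_GkM0 {k : ℕ} (a b : GkV k) : s(a, b) ∈ GkM0 k ↔ b = m0p a := by
  cases a <;> cases b <;> simp [GkM0, m0p, eq_comm]

theorem GkM0_pm (k : ℕ) : IsPM (Gk k) (GkM0 k) := by
  refine pm_of ?_ ?_ ?_
  · intro a b h
    rw [mem_GkM0] at h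
    subst h
    cases a <;> simp [m0p, Gk, GkRel]
  · intro a b c hb hc
    rw [mem_GkM0] at hb hc
    rw [hb, hc]
  · intro a
    exact ⟨m0p a, (mem_GkM0 _ _).2 rfl⟩

theorem side_free {k : ℕ} {u w : Fin k → GkV k} (S : GkSide k u w) {M : Set (Sym2 (GkV k))}
    (h : IsPM (Gk k) M) (hb : ∃ i, s(u i, w i) ∉ M) : ∃ p, ∀ i, s(u i, w p) ∉ M := by
  by_contra! hc
  choose g hg using hc
  have hle : ∀ p, g p ≤ p := by
    intro p
    rcases S.uadj _ _ (pm_adj h (hg p)) with ⟨j, hj, hj'⟩ | hj | hj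
    · exact (S.winj hj').symm ▸ hj
    · exact absurd hj (S.wx1 _)
    · exact absurd hj (S.wx2 _)
  have hinj : Function.Injective g := by
    intro p q hpq
    have h1 := hg p
    rw [hpq] at h1
    exact S.winj (pm_unique h h1 (hg q))
  have hid : ∀ p, g p = p := by
    intro p
    induction p using WellFoundedLT.induction with
    | ind p ih =>
      by_contra hne
      exact hne (hinj (ih (g p) (lt_of_le_of_ne (hle p) hne)))
  obtain ⟨i, hi⟩ := hb
  exact hi (by simpa [hid i] using hg i)

theorem side_step {k : ℕ} {u w : Fin k → GkV k} (S : GkSide k u w) {M : Set (Sym2 (GkV k))}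
    (h : IsPM (Gk k) M) (hb : ∃ i, s(u i, w i) ∉ M) :
    ∃ (p : Fin k) (M' : Set (Sym2 (GkV k))) (h' : IsPM (Gk k) M'),
      (TransGraph (Gk k)).Adj ⟨M, h⟩ ⟨M', h'⟩ ∧
      s(u p, w p) ∉ M ∧ s(u p, w p) ∈ M' ∧ GkM0 k \ M' ⊆ GkM0 k \ M := by
  obtain ⟨p, hp⟩ := side_free S h hb
  obtain ⟨c, hc⟩ := pm_partner h (u p)
  obtain ⟨d, hd⟩ := pm_partner h (w p)
  have hcd : (Gk k).Adj c d := by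
    apply S.clique
    · rcases S.uadj _ _ (pm_adj h hc) with ⟨j, -, hj⟩ | hj
      · exact Or.inl ⟨j, hj⟩
      · exact Or.inr hj
    · rcases S.wadj _ _ (pm_adj h hd) with ⟨j, rfl⟩ | hj
      · exact absurd (by rwa [Sym2.eq_swap] at hd) (hp j)
      · exact hj
    · rintro rfl
      rw [Sym2.eq_swap] at hc hd
      exact S.uw _ _ (pm_unique h hc hd)
  obtain ⟨M', h', h1, h2, h3⟩ := switch_step_s13 h (GkM0_pm k) (S.mem0 p) (hp p) hc hd hcd
  exact ⟨p, M', h', h1, hp p, h2, h3⟩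

theorem side_x1 {k : ℕ} {u w : Fin k → GkV k} (S : GkSide k u w) {M : Set (Sym2 (GkV k))}
    (h : IsPM (Gk k) M) (hb : ∃ i, s(u i, w i) ∉ M) :
    ∃ i, s(.x1, u i) ∈ M ∨ s(.x1, w i) ∈ M := by
  obtain ⟨p, hp⟩ := side_free S h hb
  obtain ⟨d, hd⟩ := pm_partner h (w p)
  choose f hf using fun i => pm_partner h (u i)
  by_cases hdx : d = .x1
  · subst hdx
    exact ⟨p, Or.inr (by rwa [Sym2.eq_swap])⟩
  have finj : Function.Injective f := by
    intro i j hij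
    have h1 := hf i
    have h2 := hf j
    rw [hij, Sym2.eq_swap] at h1
    rw [Sym2.eq_swap] at h2
    exact S.uinj (pm_unique h h1 h2)
  let T : Finset (GkV k) := insert .x1 (insert .x2 (Finset.univ.image w))
  have hT : T.card = k + 2 := by
    rw [Finset.card_insert_of_notMem, Finset.card_insert_of_notMem,
      Finset.card_image_of_injective _ S.winj, Finset.card_univ, Fintype.card_fin]
    · simpa using S.wx2
    · simpa using S.wx1
  have hwT : w p ∈ T := by simp [T]
  have hdT : d ∈ T := by
    rcases S.wadj _ _ (pm_adj h hd) with ⟨j, rfl⟩ | ⟨j, rfl⟩ | rfl | rfl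
    · exact absurd (by rwa [Sym2.eq_swap] at hd) (hp j)
    · simp [T]
    · simp [T]
    · simp [T]
  have hwd : w p ≠ d := (pm_adj h hd).ne
  have hcard : ((T.erase (w p)).erase d).card = k := by
    rw [Finset.card_erase_of_mem, Finset.card_erase_of_mem hwT, hT]
    · rfl
    · exact Finset.mem_erase.2 ⟨hwd.symm, hdT⟩
  have hsub : Finset.univ.image f ⊆ (T.erase (w p)).erase d := by
    intro v hv
    obtain ⟨i, -, rfl⟩ := Finset.mem_image.1 hv
    refine Finset.mem_erase.2 ⟨?_, Finset.mem_erase.2 ⟨?_, ?_⟩⟩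
    · intro hfd
      have h1 := hf i
      rw [hfd, Sym2.eq_swap] at h1
      rw [Sym2.eq_swap] at hd
      exact S.uw _ _ (pm_unique h h1 hd)
    · intro hfd
      exact hp i (hfd ▸ hf i)
    · rcases S.uadj _ _ (pm_adj h (hf i)) with ⟨j, -, hj⟩ | hj | hj <;> rw [hj] <;> simp [T]
  have heq := Finset.eq_of_subset_of_card_le hsub (by
    rw [hcard, Finset.card_image_of_injective _ finj, Finset.card_univ, Fintype.card_fin])
  have hx : GkV.x1 ∈ (T.erase (w p)).erase d :=
    Finset.mem_erase.2 ⟨Ne.symm hdx, Finset.mem_erase.2 ⟨(S.wx1 p).symm, by simp [T]⟩⟩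
  rw [← heq] at hx
  obtain ⟨i, -, hi⟩ := Finset.mem_image.1 hx
  refine ⟨i, Or.inl ?_⟩
  rw [Sym2.eq_swap, ← hi]
  exact hf i

theorem bad_finite (k : ℕ) : (GkM0 k).Finite := by
  have h1 : {e : Sym2 (GkV k) | ∃ i : Fin k, e = s(GkV.u i, GkV.w i)}.Finite :=
    (Set.finite_range fun i : Fin k => s(GkV.u i, GkV.w i)).subset (by
      rintro e ⟨i, rfl⟩; exact ⟨i, rfl⟩)
  have h2 : {e : Sym2 (GkV k) | ∃ i : Fin k, e = s(GkV.y i, GkV.z i)}.Finite :=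
    (Set.finite_range fun i : Fin k => s(GkV.y i, GkV.z i)).subset (by
      rintro e ⟨i, rfl⟩; exact ⟨i, rfl⟩)
  exact (h1.union h2).union (Set.finite_singleton _)

theorem bad_le {k : ℕ} {M : Set (Sym2 (GkV k))} (h : IsPM (Gk k) M) :
    ((GkM0 k \ M) \ {s(.x1, .x2)}).ncard ≤ k := by
  have key : ∀ g : Fin k → Sym2 (GkV k), ((GkM0 k \ M) \ {s(.x1, .x2)}) ⊆ Set.range g →
      ((GkM0 k \ M) \ {s(.x1, .x2)}).ncard ≤ k := by
    intro g hg
    refine (Set.ncard_le_ncard hg (Set.finite_range g)).trans ?_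
    rw [← Set.image_univ]
    refine (Set.ncard_image_le Set.finite_univ).trans ?_
    simp [Set.ncard_univ]
  by_cases h1 : ∃ i, s(GkV.u i, GkV.w i) ∉ M
  · by_cases h2 : ∃ i, s(GkV.z i, GkV.y i) ∉ M
    · obtain ⟨i, hi⟩ := side_x1 (side_uw k) h h1
      obtain ⟨j, hj⟩ := side_x1 (side_zy k) h h2
      rcases hi with hi | hi <;> rcases hj with hj | hj <;> cases pm_unique h hi hj
    · push Not at h2
      apply key fun i => s(GkV.u i, GkV.w i)
      rintro e ⟨⟨(⟨i, rfl⟩ | ⟨i, rfl⟩) | he, heM⟩, hx⟩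
      · exact ⟨i, rfl⟩
      · exact absurd (by rw [Sym2.eq_swap]; exact h2 i) heM
      · exact absurd he hx
  · push Not at h1
    apply key fun i => s(GkV.y i, GkV.z i)
    rintro e ⟨⟨(⟨i, rfl⟩ | ⟨i, rfl⟩) | he, heM⟩, hx⟩
    · exact absurd (h1 i) heM
    · exact ⟨i, rfl⟩
    · exact absurd he hx

theorem any_step {k : ℕ} {M : Set (Sym2 (GkV k))} (h : IsPM (Gk k) M)
    (hne : M ≠ GkM0 k) :
    ∃ (M' : Set (Sym2 (GkV k))) (h' : IsPM (Gk k) M'),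
      (TransGraph (Gk k)).Adj ⟨M, h⟩ ⟨M', h'⟩ ∧
      ((GkM0 k \ M') \ {s(.x1, .x2)}).ncard < ((GkM0 k \ M) \ {s(.x1, .x2)}).ncard := by
  have key : ∀ u w : Fin k → GkV k, GkSide k u w → (∃ i, s(u i, w i) ∉ M) →
      ∃ (M' : Set (Sym2 (GkV k))) (h' : IsPM (Gk k) M'),
      (TransGraph (Gk k)).Adj ⟨M, h⟩ ⟨M', h'⟩ ∧
      ((GkM0 k \ M') \ {s(.x1, .x2)}).ncard < ((GkM0 k \ M) \ {s(.x1, .x2)}).ncard := by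
    intro u w S hb
    obtain ⟨p, M', h', hadj, hp, hp', hsub⟩ := side_step S h hb
    refine ⟨M', h', hadj, ?_⟩
    apply Set.ncard_lt_ncard _ ((bad_finite k).sdiff.sdiff)
    refine ⟨Set.sdiff_subset_sdiff_left hsub, fun hc => ?_⟩
    refine (hc ⟨⟨S.mem0 p, hp⟩, ?_⟩).1.2 hp'
    intro he
    rcases Sym2.eq_iff.1 he with ⟨h1, -⟩ | ⟨h1, -⟩
    · exact S.ux1 p h1
    · exact S.ux2 p h1
  by_cases h1 : ∃ i, s(GkV.u i, GkV.w i) ∉ M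
  · exact key _ _ (side_uw k) h1
  by_cases h2 : ∃ i, s(GkV.z i, GkV.y i) ∉ M
  · exact key _ _ (side_zy k) h2
  push Not at h1 h2
  exfalso
  apply hne
  have h2' : ∀ i, s(GkV.y i, GkV.z i) ∈ M := fun i => by rw [Sym2.eq_swap]; exact h2 i
  have hx : s(GkV.x1, GkV.x2) ∈ M := by
    obtain ⟨b, hb⟩ := pm_partner h .x1
    have hb' := hb
    rw [Sym2.eq_swap] at hb'
    cases b with
    | x2 => exact hb
    | x1 => exact absurd rfl (pm_adj h hb).ne
    | u i => cases pm_unique h hb' (h1 i)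
    | z i => cases pm_unique h hb' (h2 i)
    | y i => cases pm_unique h hb' (h2' i)
    | w i => cases pm_unique h hb' (by rw [Sym2.eq_swap]; exact h1 i : s(GkV.w i, GkV.u i) ∈ M)
  refine (pm_eq (GkM0_pm k) h ?_).symm
  rintro e ((⟨i, rfl⟩ | ⟨i, rfl⟩) | he)
  · exact h1 i
  · exact h2' i
  · rw [Set.mem_singleton_iff.1 he]; exact hx

theorem walk_exists {k : ℕ} (n : ℕ) : ∀ (M : Set (Sym2 (GkV k))) (h : IsPM (Gk k) M),
    ((GkM0 k \ M) \ {s(.x1, .x2)}).ncard ≤ n →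
    ∃ p : (TransGraph (Gk k)).Walk ⟨M, h⟩ ⟨GkM0 k, GkM0_pm k⟩, p.length ≤ n := by
  induction n with
  | zero =>
    intro M h hn
    by_cases hne : M = GkM0 k
    · subst hne
      exact ⟨.nil, le_rfl⟩
    · obtain ⟨M', h', -, hlt⟩ := any_step h hne
      omega
  | succ n ih =>
    intro M h hn
    by_cases hne : M = GkM0 k
    · subst hne
      exact ⟨.nil, by simp⟩
    · obtain ⟨M', h', hadj, hlt⟩ := any_step h hne
      obtain ⟨p, hp⟩ := ih M' h' (by omega)
      exact ⟨.cons hadj p, by simpa using hp⟩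

/-- For every `k ≥ 1`, every perfect matching of `G_k` is at
distance at most `k` from `M₀` in the transition graph `𝒢(G_k)`; in
particular, `𝒢(G_k)` is connected. -/
theorem Gk_dist_le (k : ℕ) (hk : 1 ≤ k) :
    ∃ h₀ : IsPM (Gk k) (GkM0 k),
      (∀ M : {M : Set (Sym2 (GkV k)) // IsPM (Gk k) M},
        (TransGraph (Gk k)).Reachable M ⟨GkM0 k, h₀⟩ ∧
          (TransGraph (Gk k)).dist M ⟨GkM0 k, h₀⟩ ≤ k) ∧
      (TransGraph (Gk k)).Connected := by
  have main : ∀ M : {M : Set (Sym2 (GkV k)) // IsPM (Gk k) M},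
        (TransGraph (Gk k)).Reachable M ⟨GkM0 k, GkM0_pm k⟩ ∧
          (TransGraph (Gk k)).dist M ⟨GkM0 k, GkM0_pm k⟩ ≤ k := by
    rintro ⟨M, h⟩
    obtain ⟨p, hp⟩ := walk_exists k M h (bad_le h)
    exact ⟨⟨p⟩, (SimpleGraph.dist_le p).trans hp⟩
  refine ⟨GkM0_pm k, main, ?_⟩
  haveI : Nonempty {M : Set (Sym2 (GkV k)) // IsPM (Gk k) M} := ⟨⟨GkM0 k, GkM0_pm k⟩⟩
  exact ⟨fun M N => (main M).1.trans (main N).1.symm⟩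
end
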